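/- arXiv:2003.01740 — 2 statements merged into one kernel-verified Lean document; each statement's English description precedes it below -/
import Mathlib

section
/- For every n ≥ 0, the number q_n of walks of length n in the quarter plane ℕ × ℕ that start and end at (0,0) and use only the steps (−1,−1), (0,1), (1,0) (reverse Kreweras excursions) satisfies q_n = ∑_{k∈ℤ} (−1)^k ẽ_{n,k} (a finite sum). Equivalently, the generating function of reverse Kreweras quarter-plane excursions equals Ẽ(t,−1). -/
open scoped BigOperators
noncomputable section

abbrev WSt : Type := ℤ × ℕ × ℕ

def cellStep (v w : WSt) : Prop :=
  w = (v.1, v.2.1 + 1, v.2.2 + 1) ∨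
  (1 ≤ v.2.2 ∧ w = (v.1, v.2.1, v.2.2 - 1)) ∨
  (1 ≤ v.2.1 ∧ w = (v.1, v.2.1 - 1, v.2.2)) ∨
  (v.2.1 = 0 ∧ w = (v.1 + 1, v.2.2, 0)) ∨
  (v.2.2 = 0 ∧ w = (v.1 - 1, 0, v.2.1 + 1))

def vertStep (v w : WSt) : Prop :=
  w = (v.1, v.2.1 + 1, v.2.2 + 1) ∨
  (1 ≤ v.2.2 ∧ w = (v.1, v.2.1, v.2.2 - 1)) ∨
  (1 ≤ v.2.1 ∧ w = (v.1, v.2.1 - 1, v.2.2)) ∨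
  (v.2.1 = 0 ∧ 1 ≤ v.2.2 ∧ w = (v.1 + 1, v.2.2 - 1, 0)) ∨
  (v.2.2 = 0 ∧ w = (v.1 - 1, 0, v.2.1 + 2))

def pathCount (step : WSt → WSt → Prop) (n : ℕ) (v : WSt) : ℕ :=
  Nat.card {p : Fin (n + 1) → WSt //
    p 0 = ((0 : ℤ), 0, 0) ∧ p (Fin.last n) = v ∧
    ∀ i : Fin n, step (p i.castSucc) (p i.succ)}

/-- number of cell-centred excursions of length `n` with winding angle `2πk/3` -/
def eCell (n : ℕ) (k : ℤ) : ℕ := pathCount cellStep n (k, 0, 0)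

/-- number of vertex-centred walks of length `n` with winding angle `2πk/3` -/
def eVert (n : ℕ) (k : ℤ) : ℕ := pathCount vertStep n (k, 0, 0)

/-- The series `T_k(u,q)`. -/
def Tk (k : ℕ) (u q : ℂ) : ℂ :=
  ∑' n : ℕ, (-1 : ℂ) ^ n * ((2 * n + 1 : ℕ) : ℂ) ^ k * q ^ (n * (n + 1) / 2) *
    (u ^ (n + 1) - (-1 : ℂ) ^ k * u ^ (-(n : ℤ)))

/-- Jacobi theta function θ₁₁. -/
def jTheta (z τ : ℂ) : ℂ :=
  ∑' n : ℤ, (-1 : ℂ) ^ n *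
    Complex.exp (((2 * (n : ℂ) + 1) / 2) ^ 2 * Complex.I * (Real.pi : ℂ) * τ +
      (2 * (n : ℂ) + 1) * Complex.I * z)

/-- derivative of θ with respect to z -/
def jTheta' (z τ : ℂ) : ℂ := deriv (fun w => jTheta w τ) z

/-- reverse Kreweras steps `(−1,−1), (0,1), (1,0)` in the quarter plane `ℕ × ℕ` -/
def rkStep (v w : ℕ × ℕ) : Prop :=
  (1 ≤ v.1 ∧ 1 ≤ v.2 ∧ w = (v.1 - 1, v.2 - 1)) ∨ w = (v.1, v.2 + 1) ∨ w = (v.1 + 1, v.2)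

/-- number of reverse Kreweras excursions of length `n` in the quarter plane -/
def rkExcursions (n : ℕ) : ℕ :=
  Nat.card {p : Fin (n + 1) → ℕ × ℕ //
    p 0 = (0, 0) ∧ p (Fin.last n) = (0, 0) ∧
    ∀ i : Fin n, rkStep (p i.castSucc) (p i.succ)}

/-- The number of walks of length `n` from `s` to `v` with steps in the relation `step`. -/
def walkCount {α : Type*} (step : α → α → Prop) (s : α) (n : ℕ) (v : α) : ℕ :=
  Nat.card {p : Fin (n + 1) → α //
    p 0 = s ∧ p (Fin.last n) = v ∧ ∀ i : Fin n, step (p i.castSucc) (p i.succ)}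

/-- A walk of length `n + 1` is a walk of length `n` followed by a last step. -/
def walkSuccEquiv {α : Type*} (step : α → α → Prop) (s : α) (n : ℕ) (v : α) :
    {p : Fin (n + 2) → α //
      p 0 = s ∧ p (Fin.last (n + 1)) = v ∧
        ∀ i : Fin (n + 1), step (p i.castSucc) (p i.succ)} ≃
    Σ u : {u // step u v}, {p : Fin (n + 1) → α //
      p 0 = s ∧ p (Fin.last n) = u.1 ∧ ∀ i : Fin n, step (p i.castSucc) (p i.succ)} where
  toFun p := ⟨⟨p.1 (Fin.last n).castSucc, by
      have h := p.2.2.2 (Fin.last n)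
      rwa [Fin.succ_last, p.2.2.1] at h⟩,
    ⟨fun i => p.1 i.castSucc, p.2.1, rfl, fun i => p.2.2.2 i.castSucc⟩⟩
  invFun q := ⟨Fin.snoc (α := fun _ => α) q.2.1 v, by
    obtain ⟨⟨u, hu⟩, p, h0, hl, hs⟩ := q
    refine ⟨?_, by simp, fun i => ?_⟩
    · exact (Fin.snoc_castSucc (α := fun _ => α) v p 0).trans h0
    · refine Fin.lastCases ?_ (fun j => ?_) i
      · rw [Fin.snoc_castSucc, Fin.succ_last, Fin.snoc_last]
        dsimp only at hl ⊢
        rw [hl]; exact hu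
      · rw [Fin.snoc_castSucc, Fin.succ_castSucc, Fin.snoc_castSucc]
        exact hs j⟩
  left_inv p := by
    obtain ⟨p, h0, hl, hs⟩ := p
    refine Subtype.ext (funext fun i => ?_)
    refine Fin.lastCases ?_ (fun j => ?_) i
    · simp [hl]
    · simp
  right_inv q := by
    obtain ⟨⟨u, hu⟩, p, h0, hl, hs⟩ := q
    dsimp only at hl
    subst hl
    exact Sigma.subtype_ext (Subtype.ext (by simp)) (by simp)

section walkCount

variable {α : Type*} {step : α → α → Prop} {s : α}

theorem walkCount_zero [DecidableEq α] (v : α) :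
    walkCount step s 0 v = if v = s then 1 else 0 := by
  unfold walkCount
  split_ifs with h
  · subst h
    rw [Nat.card_eq_one_iff_unique]
    refine ⟨⟨fun p q => Subtype.ext (funext fun i => ?_)⟩, ⟨fun _ => v, rfl, rfl, fun i => i.elim0⟩⟩
    rw [Fin.fin_one_eq_zero i, p.2.1, q.2.1]
  · rw [Nat.card_eq_zero]
    exact Or.inl ⟨fun p => h (p.2.2.1.symm.trans p.2.1)⟩

theorem finite_walks (pre : α → Finset α) (hpre : ∀ u v, step u v ↔ u ∈ pre v) (n : ℕ) (v : α) :
    Finite {p : Fin (n + 1) → α //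
      p 0 = s ∧ p (Fin.last n) = v ∧ ∀ i : Fin n, step (p i.castSucc) (p i.succ)} := by
  induction n generalizing v with
  | zero =>
    refine @Finite.of_subsingleton _ ⟨fun p q => Subtype.ext (funext fun i => ?_)⟩
    rw [Fin.fin_one_eq_zero i, p.2.1, q.2.1]
  | succ n ih =>
    have : Finite {u // step u v} := by
      simp only [hpre]
      infer_instance
    have := fun u : {u // step u v} => ih u.1
    exact Finite.of_equiv _ (walkSuccEquiv step s n v).symm

theorem walkCount_succ (pre : α → Finset α) (hpre : ∀ u v, step u v ↔ u ∈ pre v)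
    (n : ℕ) (v : α) :
    walkCount step s (n + 1) v = ∑ u ∈ pre v, walkCount step s n u := by
  have : Fintype {u // step u v} := Fintype.ofFinset (pre v) fun u => (hpre u v).symm
  have := fun u : {u // step u v} => finite_walks (s := s) pre hpre n u.1
  rw [Finset.sum_subtype (pre v) fun u => (hpre u v).symm]
  unfold walkCount
  rw [Nat.card_congr (walkSuccEquiv step s n v), Nat.card_sigma]

end walkCount

/-- The points from which a vertex-centred Kreweras step leads to a given point. -/
def vertPre : WSt → Finset WSt
  | (k, 0, 0) => {(k, 0, 1), (k, 1, 0), (k - 1, 0, 1)}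
  | (k, a + 1, 0) => {(k, a + 1, 1), (k, a + 2, 0), (k - 1, 0, a + 2)}
  | (k, 0, 1) => {(k, 0, 2), (k, 1, 1)}
  | (k, 0, b + 2) => {(k, 0, b + 3), (k, 1, b + 2), (k + 1, b, 0)}
  | (k, a + 1, b + 1) => {(k, a, b), (k, a + 1, b + 2), (k, a + 2, b + 1)}

theorem vertStep_iff_mem_vertPre (u v : WSt) : vertStep u v ↔ u ∈ vertPre v := by
  obtain ⟨k', a', b'⟩ := u
  obtain ⟨k, _ | a, _ | _ | b⟩ := v <;> simp [vertStep, vertPre] <;> omega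

/-- The points from which a reverse Kreweras step leads to a given point. -/
def rkPre : ℕ × ℕ → Finset (ℕ × ℕ)
  | (0, 0) => {(1, 1)}
  | (0, b + 1) => {(1, b + 2), (0, b)}
  | (a + 1, 0) => {(a + 2, 1), (a, 0)}
  | (a + 1, b + 1) => {(a + 2, b + 2), (a + 1, b), (a, b + 1)}

theorem rkStep_iff_mem_rkPre (u v : ℕ × ℕ) : rkStep u v ↔ u ∈ rkPre v := by
  obtain ⟨a', b'⟩ := u
  obtain ⟨_ | a, _ | b⟩ := v <;> simp [rkStep, rkPre] <;> omega

/-- The generating polynomial in the winding number, evaluated at `-1`, of the vertex-centred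
walks of length `n` ending at the point `(a, b)` of some wedge. -/
def signedCount : ℕ → ℕ → ℕ → ℂ
  | 0, a, b => if a = 0 ∧ b = 0 then 1 else 0
  | n + 1, a, 0 => signedCount n a 1 + signedCount n (a + 1) 0 - signedCount n 0 (a + 1)
  | n + 1, 0, 1 => signedCount n 0 2 + signedCount n 1 1
  | n + 1, 0, b + 2 =>
    signedCount n 0 (b + 3) + signedCount n 1 (b + 2) - signedCount n b 0
  | n + 1, a + 1, b + 1 =>
    signedCount n a b + signedCount n (a + 1) (b + 2) + signedCount n (a + 2) (b + 1)

theorem HasSum.alternating_shift {f : ℤ → ℂ} {x : ℂ}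
    (h : HasSum (fun k => f k * (-1 : ℂ) ^ k) x) (j : ℤ) (hj : Odd j) :
    HasSum (fun k => f (k + j) * (-1 : ℂ) ^ k) (-x) := by
  have h' := ((Equiv.addRight j).hasSum_iff.mpr h).neg
  refine h'.congr_fun fun k => ?_
  simp [zpow_add₀, hj.neg_one_zpow]

theorem hasSum_signedCount (n a b : ℕ) :
    HasSum (fun k : ℤ => (walkCount vertStep (0, 0, 0) n (k, a, b) : ℂ) * (-1 : ℂ) ^ k)
      (signedCount n a b) := by
  induction n generalizing a b with
  | zero =>
    convert hasSum_single (0 : ℤ) fun k hk => ?_ using 1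
    · simp [walkCount_zero, signedCount]
    · simp [walkCount_zero, hk]
  | succ n ih =>
    have hl := fun a b => (ih a b).alternating_shift (-1) (by decide)
    have hr := fun a b => (ih a b).alternating_shift 1 (by decide)
    simp only [walkCount_succ vertPre vertStep_iff_mem_vertPre]
    have hk := fun k : ℤ => (sub_one_lt k).ne'
    rcases a with _ | a <;> rcases b with _ | _ | b
    · simpa [vertPre, signedCount, add_mul, sub_eq_add_neg, add_assoc, hk] using
        ((ih 0 1).add (ih 1 0)).add (hl 0 1)
    · simpa [vertPre, signedCount, add_mul, sub_eq_add_neg, add_assoc] using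
        (ih 0 2).add (ih 1 1)
    · simpa [vertPre, signedCount, add_mul, sub_eq_add_neg, add_assoc] using
        ((ih 0 (b + 3)).add (ih 1 (b + 2))).add (hr b 0)
    · simpa [vertPre, signedCount, add_mul, sub_eq_add_neg, add_assoc] using
        ((ih (a + 1) 1).add (ih (a + 2) 0)).add (hl 0 (a + 2))
    · simpa [vertPre, signedCount, add_mul, sub_eq_add_neg, add_assoc] using
        ((ih a 0).add (ih (a + 1) 2)).add (ih (a + 2) 1)
    · simpa [vertPre, signedCount, add_mul, sub_eq_add_neg, add_assoc] using
        ((ih a (b + 1)).add (ih (a + 1) (b + 3))).add (ih (a + 2) (b + 2))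

theorem walkCount_rkStep_comm (n a b : ℕ) :
    walkCount rkStep (0, 0) n (a, b) = walkCount rkStep (0, 0) n (b, a) := by
  induction n generalizing a b with
  | zero => simp [walkCount_zero, and_comm]
  | succ n ih =>
    simp only [walkCount_succ rkPre rkStep_iff_mem_rkPre]
    rcases a with _ | a <;> rcases b with _ | b
    · rfl
    · simp [rkPre, ih 1, ih 0]
    · simp [rkPre, ih _ 1, ih _ 0]
    · simp [rkPre, ih (a + 2), ih (a + 1), ih a, add_comm]

/-- Reflection principle: the reverse Kreweras walks in the quarter plane are the part of the
signed vertex-centred walks that is antisymmetric in the axis of the wedge. -/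
theorem two_mul_walkCount_rkStep (n q : ℕ) :
    (walkCount rkStep (0, 0) n (q, q) : ℂ) = signedCount n q 0 ∧
    ∀ b, 2 * (walkCount rkStep (0, 0) n (q + b + 1, q) : ℂ) =
      signedCount n (q + b + 1) (b + 1) - signedCount n b (q + b + 2) := by
  induction n generalizing q with
  | zero => simp [walkCount_zero, signedCount]
  | succ n ih =>
    simp only [walkCount_succ rkPre rkStep_iff_mem_rkPre]
    constructor
    · have h := (ih (q + 1)).1
      rcases q with _ | q
      · simp [rkPre, signedCount, h]
      · have h' := (ih q).2 0
        simp [rkPre, signedCount, walkCount_rkStep_comm n q] at h h' ⊢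
        linear_combination h + h'
    · intro b
      have h₁ := (ih (q + 1)).2 b
      rw [show q + 1 + b + 1 = q + b + 2 by ring, show q + 1 + b + 2 = q + b + 3 by ring] at h₁
      have h₃ : 2 * (walkCount rkStep (0, 0) n (q + b, q) : ℂ) =
          signedCount n (q + b) b - match b with
            | 0 => -signedCount n q 0
            | b + 1 => signedCount n b (q + b + 2) := by
        rcases b with _ | b
        · have := (ih q).1
          simp
          linear_combination 2 * this
        · exact (ih q).2 b
      rcases q with _ | q
      · rcases b with _ | b <;>
        · simp [rkPre, signedCount] at h₁ h₃ ⊢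
          linear_combination h₁ + h₃
      · have h₂ := (ih q).2 (b + 1)
        rw [show q + (b + 1) + 1 = q + 1 + b + 1 by ring,
          show q + (b + 1) + 2 = q + 1 + b + 2 by ring] at h₂
        rcases b with _ | b <;>
        · simp [rkPre, signedCount, ← add_assoc] at h₁ h₂ h₃ ⊢
          linear_combination h₁ + h₂ + h₃

/-- Example 1: reverse Kreweras quarter-plane excursions are counted by
`Ẽ(t,−1)`, i.e. `q_n = ∑_k (−1)^k ẽ_{n,k}`. -/
theorem reverse_kreweras_excursions (n : ℕ) :
    (rkExcursions n : ℂ) = ∑' k : ℤ, (eVert n k : ℂ) * (-1 : ℂ) ^ k :=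
  (two_mul_walkCount_rkStep n 0).1.trans (hasSum_signedCount n 0 0).tsum_eq.symm
end
end

section
/- Let τ ∈ iℝ_{>0}, set t = e^{−πτi/3} θ'(0,3τ)/(4i θ(πτ,3τ) + 6 θ'(πτ,3τ)), and assume 0 < t < 1/3. Then for every α ∈ ℝ with e^{3iα} ≠ 1, the convergent sum ∑_{n≥0} t^n ∑_{k∈ℤ} e_{n,k} e^{ikα} equals (e^{iα}/(t(1−e^{3iα}))) · ( e^{iα} − e^{4πτi/3} θ'(2πτ,3τ)/θ'(0,3τ) − e^{πτi/3} θ(πτ,3τ) θ'(α/2 − 2πτ/3, τ)/(θ'(0,3τ) θ(α/2 − 2πτ/3, τ)) ). -/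
open scoped BigOperators
noncomputable section

open Filter Topology

/-- Paths of length `n` starting at the origin, with free endpoint. -/
def CellPath (n : ℕ) : Type :=
  {p : Fin (n + 1) → WSt // p 0 = ((0 : ℤ), 0, 0) ∧ ∀ i : Fin n, cellStep (p i.castSucc) (p i.succ)}

/-- The endpoint of a path. -/
def CellPath.endpoint {n : ℕ} (p : CellPath n) : WSt := p.1 (Fin.last n)

lemma CellPath.sigma_ext {n : ℕ} {q r : Σ p : CellPath n, {w : WSt // cellStep p.endpoint w}}
    (h : q.1.1 = r.1.1) (h' : q.2.1 = r.2.1) : q = r := by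
  obtain ⟨⟨p, hp⟩, w, hw⟩ := q
  obtain ⟨⟨p', hp'⟩, w', hw'⟩ := r
  obtain rfl : p = p' := h
  obtain rfl : w = w' := h'
  rfl

/-- A path of length `n + 1` is a path of length `n` followed by one step. -/
def CellPath.succEquiv (n : ℕ) :
    CellPath (n + 1) ≃ Σ p : CellPath n, {w : WSt // cellStep p.endpoint w} where
  toFun p := ⟨⟨fun i => p.1 i.castSucc, p.2.1, fun i => p.2.2 i.castSucc⟩,
    ⟨p.1 (Fin.last _), p.2.2 (Fin.last n)⟩⟩
  invFun q := ⟨Fin.snoc (α := fun _ => WSt) q.1.1 q.2.1, by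
    refine ⟨(Fin.snoc_castSucc (α := fun _ => WSt) q.2.1 q.1.1 0).trans q.1.2.1, fun i => ?_⟩
    refine Fin.lastCases ?_ (fun j => ?_) i
    · rw [Fin.snoc_castSucc, Fin.succ_last, Fin.snoc_last]; exact q.2.2
    · rw [Fin.snoc_castSucc, Fin.succ_castSucc, Fin.snoc_castSucc]; exact q.1.2.2 j⟩
  left_inv p := by
    apply Subtype.ext
    exact Fin.snoc_init_self p.1
  right_inv q := by
    refine CellPath.sigma_ext (funext fun i => ?_) ?_
    · exact Fin.snoc_castSucc (α := fun _ => WSt) ..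
    · exact Fin.snoc_last (α := fun _ => WSt) ..

/-- The successors of a state. -/
def cellSucc (v : WSt) : Finset WSt :=
  {(v.1, v.2.1 + 1, v.2.2 + 1),
    if v.2.2 = 0 then (v.1 - 1, 0, v.2.1 + 1) else (v.1, v.2.1, v.2.2 - 1),
    if v.2.1 = 0 then (v.1 + 1, v.2.2, 0) else (v.1, v.2.1 - 1, v.2.2)}

lemma mem_cellSucc (v w : WSt) : w ∈ cellSucc v ↔ cellStep v w := by
  obtain ⟨k, a, b⟩ := v
  rcases Nat.eq_zero_or_pos a with rfl | ha <;> rcases Nat.eq_zero_or_pos b with rfl | hb <;>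
    simp [cellSucc, cellStep] <;> grind

lemma sum_cellSucc (v : WSt) (f : WSt → ℂ) :
    ∑ w ∈ cellSucc v, f w = f (v.1, v.2.1 + 1, v.2.2 + 1) +
      (f (if v.2.2 = 0 then (v.1 - 1, 0, v.2.1 + 1) else (v.1, v.2.1, v.2.2 - 1)) +
      f (if v.2.1 = 0 then (v.1 + 1, v.2.2, 0) else (v.1, v.2.1 - 1, v.2.2))) := by
  obtain ⟨k, a, b⟩ := v
  unfold cellSucc
  rw [Finset.sum_insert, Finset.sum_insert, Finset.sum_singleton]
  · rw [Finset.mem_singleton]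
    rcases Nat.eq_zero_or_pos a with rfl | ha <;> rcases Nat.eq_zero_or_pos b with rfl | hb <;> 
      simp [Prod.ext_iff] <;> grind
  · simp only [Finset.mem_insert, Finset.mem_singleton]
    rcases Nat.eq_zero_or_pos a with rfl | ha <;> rcases Nat.eq_zero_or_pos b with rfl | hb <;> 
      simp [Prod.ext_iff] <;> grind

instance CellPath.instFinite (n : ℕ) : Finite (CellPath n) := by
  induction n with
  | zero =>
    refine @Finite.of_subsingleton _ ⟨fun p q => Subtype.ext (funext fun i => ?_)⟩
    rw [Fin.fin_one_eq_zero i, p.2.1, q.2.1]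
  | succ n ih =>
    have (p : CellPath n) : Finite {w : WSt // cellStep p.endpoint w} :=
      Finite.of_equiv (cellSucc p.endpoint)
        (Equiv.subtypeEquivRight fun w => mem_cellSucc p.endpoint w)
    exact Finite.of_equiv _ (CellPath.succEquiv n).symm

instance CellPath.instFintype (n : ℕ) : Fintype (CellPath n) := Fintype.ofFinite _

/-- The sum of `f` over the endpoints of all paths of length `n`. -/
def pathSum (n : ℕ) (f : WSt → ℂ) : ℂ := ∑ p : CellPath n, f p.endpoint

lemma pathSum_zero (f : WSt → ℂ) : pathSum 0 f = f (0, 0, 0) := by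
  have hu (p : CellPath 0) : p.endpoint = (0, 0, 0) := p.2.1
  have : Unique (CellPath 0) :=
    { default := ⟨fun _ => (0, 0, 0), rfl, fun i => i.elim0⟩
      uniq := fun p => Subtype.ext (funext fun i => by rw [Fin.fin_one_eq_zero i]; exact p.2.1) }
  rw [pathSum, Fintype.sum_unique, hu]

lemma pathSum_succ (n : ℕ) (f : WSt → ℂ) :
    pathSum (n + 1) f = pathSum n (fun v => ∑ w ∈ cellSucc v, f w) := by
  classical
  unfold pathSum
  have (p : CellPath n) : Fintype {w : WSt // cellStep p.endpoint w} :=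
    Fintype.subtype (cellSucc p.endpoint) (mem_cellSucc _)
  rw [← Equiv.sum_comp (CellPath.succEquiv n).symm, Fintype.sum_sigma]
  refine Finset.sum_congr rfl fun p _ => ?_
  beta_reduce
  rw [Finset.sum_subtype (cellSucc p.endpoint) (mem_cellSucc _)]
  refine Finset.sum_congr rfl fun w _ => ?_
  exact congrArg f (Fin.snoc_last (α := fun _ => WSt) w.1 p.1)

lemma norm_pathSum_le (n : ℕ) (f : WSt → ℂ) (hf : ∀ v, ‖f v‖ ≤ 1) : ‖pathSum n f‖ ≤ 3 ^ n := by
  have key : ∀ (n : ℕ) (C : ℝ) (f : WSt → ℂ), (∀ v, ‖f v‖ ≤ C) → ‖pathSum n f‖ ≤ 3 ^ n * C := by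
    intro n
    induction n with
    | zero => intro C f h; rw [pathSum_zero]; simpa using h _
    | succ n ih =>
      intro C f h
      rw [pathSum_succ]
      refine (ih (3 * C) _ fun v => ?_).trans (le_of_eq (by ring))
      rw [sum_cellSucc]
      rw [← add_assoc]
      refine norm_add₃_le.trans ?_
      linarith [h (v.1, v.2.1 + 1, v.2.2 + 1),
        h (if v.2.2 = 0 then (v.1 - 1, 0, v.2.1 + 1) else (v.1, v.2.1, v.2.2 - 1)),
        h (if v.2.1 = 0 then (v.1 + 1, v.2.2, 0) else (v.1, v.2.1 - 1, v.2.2))]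
  simpa using key n 1 f hf

lemma tsum_eCell (n : ℕ) (s : ℂ) :
    ∑' k : ℤ, (eCell n k : ℂ) * s ^ k =
      pathSum n (fun v => if v.2 = (0, 0) then s ^ v.1 else 0) := by
  classical
  have hc (k : ℤ) : eCell n k =
      (Finset.univ.filter fun p : CellPath n => p.endpoint = (k, 0, 0)).card := by
    rw [eCell, pathCount, ← Fintype.card_subtype, ← Nat.card_eq_fintype_card]
    refine Nat.card_congr ⟨fun p => ⟨⟨p.1, p.2.1, p.2.2.2⟩, p.2.2.1⟩,
      fun p => ⟨p.1.1, p.1.2.1, p.2, p.1.2.2⟩, fun p => rfl, fun p => rfl⟩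
  have hk (k : ℤ) : (eCell n k : ℂ) * s ^ k =
      ∑ p : CellPath n, if p.endpoint = (k, 0, 0) then s ^ k else 0 := by
    rw [hc, ← Finset.sum_filter, Finset.sum_const, nsmul_eq_mul]
  simp_rw [hk]
  rw [Summable.tsum_finsetSum]
  · refine Finset.sum_congr rfl fun p _ => ?_
    rw [tsum_eq_single p.endpoint.1]
    · obtain ⟨k, v⟩ := p.endpoint
      simp
    · intro k hk
      rw [if_neg]
      intro h; apply hk; rw [h]
  · intro p _
    refine summable_of_ne_finset_zero (s := {p.endpoint.1}) fun k hk => ?_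
    rw [if_neg]
    intro h; apply hk; rw [h]; simp

lemma summable_pathSum {t : ℂ} (ht : ‖t‖ < 1 / 3) (f : WSt → ℂ) (hf : ∀ v, ‖f v‖ ≤ 1) :
    Summable fun n => t ^ n * pathSum n f := by
  refine Summable.of_norm_bounded (g := fun n => (3 * ‖t‖) ^ n)
    (summable_geometric_of_lt_one (by positivity) (by linarith)) fun n => ?_
  rw [norm_mul, norm_pow, mul_pow, mul_comm]
  exact mul_le_mul_of_nonneg_right (norm_pathSum_le n f hf) (by positivity)

/-- Monomial weight of states with vanishing last coordinate. -/
def wtA (s x : ℂ) (v : WSt) : ℂ := if v.2.2 = 0 then s ^ v.1 * x ^ v.2.1 else 0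

/-- Monomial weight of states with vanishing middle coordinate. -/
def wtB (s x : ℂ) (v : WSt) : ℂ := if v.2.1 = 0 then s ^ v.1 * x ^ v.2.2 else 0

/-- Monomial weight of a state. -/
def wtQ (s x y : ℂ) (v : WSt) : ℂ := s ^ v.1 * (x ^ v.2.1 * y ^ v.2.2)

lemma norm_wtA_le {s x : ℂ} (hs : ‖s‖ = 1) (hx : ‖x‖ ≤ 1) (v : WSt) : ‖wtA s x v‖ ≤ 1 := by
  unfold wtA
  split_ifs
  · rw [norm_mul, norm_zpow, hs, one_zpow, one_mul, norm_pow]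
    exact pow_le_one₀ (norm_nonneg _) hx
  · simp

lemma norm_wtB_le {s x : ℂ} (hs : ‖s‖ = 1) (hx : ‖x‖ ≤ 1) (v : WSt) : ‖wtB s x v‖ ≤ 1 := by
  unfold wtB
  split_ifs
  · rw [norm_mul, norm_zpow, hs, one_zpow, one_mul, norm_pow]
    exact pow_le_one₀ (norm_nonneg _) hx
  · simp

lemma norm_wtQ_le {s x y : ℂ} (hs : ‖s‖ = 1) (hx : ‖x‖ ≤ 1) (hy : ‖y‖ ≤ 1) (v : WSt) :
    ‖wtQ s x y v‖ ≤ 1 := by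
  unfold wtQ
  rw [norm_mul, norm_zpow, hs, one_zpow, one_mul, norm_mul, norm_pow, norm_pow]
  exact mul_le_one₀ (pow_le_one₀ (norm_nonneg _) hx) (by positivity)
    (pow_le_one₀ (norm_nonneg _) hy)

lemma sum_cellSucc_wtQ {s x y : ℂ} (hs : s ≠ 0) (hx : x ≠ 0) (hy : y ≠ 0) (v : WSt) :
    ∑ w ∈ cellSucc v, wtQ s x y w = (x * y + 1 / x + 1 / y) * wtQ s x y v
      + (-(1 / y)) * wtA s x v + (-(1 / x)) * wtB s y v + y / s * wtA s y v + s * wtB s x v := by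
  obtain ⟨k, a, b⟩ := v
  rw [sum_cellSucc]
  unfold wtA wtB wtQ
  rcases a with _ | a <;> rcases b with _ | b <;>
    simp [zpow_add₀ hs, zpow_sub₀ hs, pow_succ] <;> field_simp <;> ring

lemma pathSum_linear (n : ℕ) (c₁ c₂ c₃ c₄ c₅ : ℂ) (f₁ f₂ f₃ f₄ f₅ : WSt → ℂ) :
    pathSum n (fun v => c₁ * f₁ v + c₂ * f₂ v + c₃ * f₃ v + c₄ * f₄ v + c₅ * f₅ v) =
      c₁ * pathSum n f₁ + c₂ * pathSum n f₂ + c₃ * pathSum n f₃ + c₄ * pathSum n f₄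
        + c₅ * pathSum n f₅ := by
  simp only [pathSum, Finset.sum_add_distrib, Finset.mul_sum]

/-- The generating function `Q(x, 0)` or `Q(0, x)`, according to the choice of weight. -/
def cellGen (t : ℂ) (f : WSt → ℂ) : ℂ := ∑' n : ℕ, t ^ n * pathSum n f

lemma cellGen_kernel {t s x y : ℂ} (ht : ‖t‖ < 1 / 3) (hs : ‖s‖ = 1) (hx : ‖x‖ ≤ 1)
    (hy : ‖y‖ ≤ 1) (hx0 : x ≠ 0) (hy0 : y ≠ 0) (hk : t * (x * y + 1 / x + 1 / y) = 1) :
    1 - t / y * cellGen t (wtA s x) - t / x * cellGen t (wtB s y)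
      + t * y / s * cellGen t (wtA s y) + t * s * cellGen t (wtB s x) = 0 := by
  have hs0 : s ≠ 0 := by rintro rfl; simp at hs
  have sQ := summable_pathSum ht _ (norm_wtQ_le hs hx hy)
  have sAx := summable_pathSum ht _ (norm_wtA_le hs hx)
  have sAy := summable_pathSum ht _ (norm_wtA_le hs hy)
  have sBx := summable_pathSum ht _ (norm_wtB_le hs hx)
  have sBy := summable_pathSum ht _ (norm_wtB_le hs hy)
  have h1 : cellGen t (wtQ s x y) = 1 + ∑' n : ℕ, t ^ (n + 1) * pathSum (n + 1) (wtQ s x y) := by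
    rw [cellGen, sQ.tsum_eq_zero_add, pathSum_zero]
    simp [wtQ]
  have h2 : ∑' n : ℕ, t ^ (n + 1) * pathSum (n + 1) (wtQ s x y) =
      t * ((x * y + 1 / x + 1 / y) * cellGen t (wtQ s x y) + (-(1 / y)) * cellGen t (wtA s x)
        + (-(1 / x)) * cellGen t (wtB s y) + y / s * cellGen t (wtA s y)
        + s * cellGen t (wtB s x)) := by
    have := (((((sQ.hasSum.mul_left (x * y + 1 / x + 1 / y)).add
      (sAx.hasSum.mul_left (-(1 / y)))).add (sBy.hasSum.mul_left (-(1 / x)))).add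
      (sAy.hasSum.mul_left (y / s))).add (sBx.hasSum.mul_left s)).mul_left t
    refine Eq.trans (tsum_congr fun n => ?_) this.tsum_eq
    rw [pathSum_succ]
    simp_rw [sum_cellSucc_wtQ hs0 hx0 hy0, pathSum_linear]
    ring
  rw [h2] at h1
  linear_combination (-1 : ℂ) * h1 - cellGen t (wtQ s x y) * hk

lemma differentiableOn_cellGen {t : ℂ} (ht : ‖t‖ < 1 / 3) (f : ℂ → WSt → ℂ)
    (hd : ∀ v, Differentiable ℂ fun x => f x v) (hf : ∀ x, ‖x‖ ≤ 1 → ∀ v, ‖f x v‖ ≤ 1) :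
    DifferentiableOn ℂ (fun x => cellGen t (f x)) (Metric.ball 0 1) := by
  unfold cellGen
  refine Complex.differentiableOn_tsum_of_summable_norm (u := fun n => (3 * ‖t‖) ^ n)
    (summable_geometric_of_lt_one (by positivity) (by linarith)) (fun n => ?_)
    Metric.isOpen_ball fun n x hx => ?_
  · unfold pathSum
    fun_prop
  · rw [norm_mul, norm_pow, mul_pow, mul_comm]
    refine mul_le_mul_of_nonneg_right (norm_pathSum_le n _ (hf x ?_)) (by positivity)
    simpa using (Metric.mem_ball.1 hx).le

lemma differentiableOn_cellGen_wtA {t s : ℂ} (ht : ‖t‖ < 1 / 3) (hs : ‖s‖ = 1) :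
    DifferentiableOn ℂ (fun x => cellGen t (wtA s x)) (Metric.ball 0 1) := by
  refine differentiableOn_cellGen ht _ (fun v => ?_) fun x hx => norm_wtA_le hs hx
  unfold wtA
  split_ifs <;> fun_prop

lemma differentiableOn_cellGen_wtB {t s : ℂ} (ht : ‖t‖ < 1 / 3) (hs : ‖s‖ = 1) :
    DifferentiableOn ℂ (fun x => cellGen t (wtB s x)) (Metric.ball 0 1) := by
  refine differentiableOn_cellGen ht _ (fun v => ?_) fun x hx => norm_wtB_le hs hx
  unfold wtB
  split_ifs <;> fun_prop

lemma tsum_tsum_eCell (t s : ℂ) :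
    ∑' n : ℕ, t ^ n * ∑' k : ℤ, (eCell n k : ℂ) * s ^ k = cellGen t (wtA s 0) := by
  unfold cellGen
  simp_rw [tsum_eCell]
  congr! with n v
  obtain ⟨k, a, b⟩ := v
  rcases a with _ | a <;> rcases b with _ | b <;> simp [wtA]

section Theta

lemma jTheta_eq (z τ : ℂ) : jTheta z τ = Complex.exp (Complex.I * Real.pi * τ / 4 + Complex.I * z) *
    jacobiTheta₂ (z / Real.pi + τ / 2 + 1 / 2) τ := by
  have hpi : (Real.pi : ℂ) ≠ 0 := Complex.ofReal_ne_zero.2 Real.pi_ne_zero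
  rw [jTheta, jacobiTheta₂, ← tsum_mul_left]
  refine tsum_congr fun n => ?_
  have h1 : (-1 : ℂ) ^ n = Complex.exp (n * (Real.pi * Complex.I)) := by
    rw [Complex.exp_int_mul, Complex.exp_pi_mul_I]
  rw [jacobiTheta₂_term, h1, ← Complex.exp_add, ← Complex.exp_add]
  congr 1
  field_simp
  ring

lemma differentiable_jTheta {τ : ℂ} (hτ : 0 < τ.im) : Differentiable ℂ fun z => jTheta z τ := by
  have : (fun z => jTheta z τ) = fun z => Complex.exp (Complex.I * Real.pi * τ / 4 + Complex.I * z) *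
    jacobiTheta₂ (z / Real.pi + τ / 2 + 1 / 2) τ := funext fun z => jTheta_eq z τ
  rw [this]
  refine Differentiable.mul (by fun_prop) fun z => ?_
  exact (differentiableAt_jacobiTheta₂_fst (z / Real.pi + τ / 2 + 1 / 2) hτ).comp z
    (f := fun z : ℂ => z / Real.pi + τ / 2 + 1 / 2) (by fun_prop)

lemma jTheta_neg (z τ : ℂ) : jTheta (-z) τ = -jTheta z τ := by
  rw [jTheta, jTheta, ← (Equiv.subLeft (-1 : ℤ)).tsum_eq, ← tsum_neg]
  refine tsum_congr fun n => ?_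
  have h1 : (-1 : ℂ) ^ (-1 - n : ℤ) = -(-1) ^ n := by
    rw [zpow_sub₀ (by norm_num), zpow_neg_one, div_eq_mul_inv, ← inv_zpow]
    norm_num
  rw [Equiv.subLeft_apply, h1, neg_mul]
  congr 3
  push_cast
  ring

lemma jTheta_add_pi (z τ : ℂ) : jTheta (z + Real.pi) τ = -jTheta z τ := by
  have hpi : (Real.pi : ℂ) ≠ 0 := Complex.ofReal_ne_zero.2 Real.pi_ne_zero
  rw [jTheta_eq, jTheta_eq, show (z + Real.pi) / Real.pi + τ / 2 + 1 / 2 =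
    (z / Real.pi + τ / 2 + 1 / 2) + 1 by field_simp; ring, jacobiTheta₂_add_left,
    show Complex.I * Real.pi * τ / 4 + Complex.I * (z + Real.pi) =
    Complex.I * Real.pi * τ / 4 + Complex.I * z + Real.pi * Complex.I by ring,
    Complex.exp_add _ (Real.pi * Complex.I), Complex.exp_pi_mul_I]
  ring

lemma jTheta_add_pi_mul (z τ : ℂ) : jTheta (z + Real.pi * τ) τ =
    -Complex.exp (-2 * Complex.I * z - Complex.I * Real.pi * τ) * jTheta z τ := by
  have hpi : (Real.pi : ℂ) ≠ 0 := Complex.ofReal_ne_zero.2 Real.pi_ne_zero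
  rw [jTheta_eq, jTheta_eq, show (z + Real.pi * τ) / Real.pi + τ / 2 + 1 / 2 =
    (z / Real.pi + τ / 2 + 1 / 2) + τ by field_simp; ring, jacobiTheta₂_add_left', ← mul_assoc,
    ← mul_assoc, ← Complex.exp_add,
    ← neg_one_mul (Complex.exp (-2 * Complex.I * z - Complex.I * Real.pi * τ)),
    ← Complex.exp_pi_mul_I, ← Complex.exp_add, ← Complex.exp_add]
  congr 1
  rw [Complex.exp_eq_exp_iff_exists_int]
  refine ⟨-1, ?_⟩
  field_simp
  push_cast
  ring

/-- The theta function with purely imaginary lattice parameter, normalised so that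
`I * η` is the second quasi-period. -/
def imTheta (η : ℝ) (z : ℂ) : ℂ := jTheta z (Complex.I * (η / Real.pi : ℝ))

variable {η : ℝ}

lemma pi_mul_I_mul_div (η : ℝ) : (Real.pi : ℂ) * (Complex.I * (η / Real.pi : ℝ)) = Complex.I * η := by
  have hpi : (Real.pi : ℂ) ≠ 0 := Complex.ofReal_ne_zero.2 Real.pi_ne_zero
  push_cast
  field_simp

lemma differentiable_imTheta (hη : 0 < η) : Differentiable ℂ (imTheta η) :=
  differentiable_jTheta (by simpa using div_pos hη Real.pi_pos)

lemma imTheta_neg (η : ℝ) (z : ℂ) : imTheta η (-z) = -imTheta η z := jTheta_neg _ _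

lemma imTheta_zero (η : ℝ) : imTheta η 0 = 0 := by
  have := imTheta_neg η 0
  rw [neg_zero] at this
  exact self_eq_neg.1 this

lemma imTheta_add_pi (η : ℝ) (z : ℂ) : imTheta η (z + Real.pi) = -imTheta η z := jTheta_add_pi _ _

lemma imTheta_add_I_mul (η : ℝ) (z : ℂ) : imTheta η (z + Complex.I * η) =
    -Complex.exp (-2 * Complex.I * z + η) * imTheta η z := by
  rw [imTheta, imTheta, ← pi_mul_I_mul_div η, jTheta_add_pi_mul, mul_assoc Complex.I,
    pi_mul_I_mul_div, ← mul_assoc, Complex.I_mul_I]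
  congr 3
  ring

lemma conj_imTheta (η : ℝ) (z : ℂ) :
    (starRingEnd ℂ) (imTheta η z) = -imTheta η ((starRingEnd ℂ) z) := by
  rw [← imTheta_neg, imTheta, imTheta, jTheta, jTheta, Complex.conj_tsum]
  refine tsum_congr fun n => ?_
  simp only [map_mul, map_zpow₀, map_neg, map_one, ← Complex.exp_conj, map_add, map_pow, map_div₀,
    Complex.conj_I, Complex.conj_ofReal, map_intCast, map_ofNat]
  congr 2
  ring

end Theta

section TripleProduct

variable {p w : ℂ} {T : ℤ → ℂ}

/-- The finite `q`-Pochhammer product `(p; p)_n`. -/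
def qPoch (p : ℂ) (n : ℕ) : ℂ := ∏ j ∈ Finset.range n, (1 - p ^ (j + 1))

/-- The inverse of `qPoch`, extended by zero to negative indices. -/
def qPochInv (p : ℂ) (n : ℤ) : ℂ := if 0 ≤ n then (qPoch p n.toNat)⁻¹ else 0

lemma one_sub_pow_ne_zero (hp : ‖p‖ < 1) (n : ℕ) : 1 - p ^ (n + 1) ≠ 0 := by
  intro h
  have : ‖p ^ (n + 1)‖ < 1 := by
    rw [norm_pow]; exact pow_lt_one₀ (norm_nonneg _) hp (by omega)
  rw [← sub_eq_zero.1 h, norm_one] at this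
  exact lt_irrefl _ this

lemma qPochInv_sub_one (hp : ‖p‖ < 1) (n : ℤ) :
    qPochInv p (n - 1) = (1 - p ^ n) * qPochInv p n := by
  rcases lt_trichotomy n 0 with h | rfl | h
  · rw [qPochInv, qPochInv, if_neg (by omega), if_neg (by omega), mul_zero]
  · simp [qPochInv]
  · obtain ⟨m, rfl⟩ : ∃ m : ℕ, n = m + 1 := ⟨(n - 1).toNat, by omega⟩
    rw [qPochInv, qPochInv, if_pos (by omega), if_pos (by omega),
      show ((m : ℤ) + 1 - 1).toNat = m by omega, show ((m : ℤ) + 1).toNat = m + 1 by omega]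
    rw [qPoch, qPoch, Finset.prod_range_succ, mul_inv]
    have := one_sub_pow_ne_zero hp m
    rw [show (p ^ ((m : ℤ) + 1)) = p ^ (m + 1) by norm_cast]
    field_simp

/-- The coefficients of the finite triple product. -/
def tripleCoeff (p : ℂ) (N : ℕ) (n : ℤ) : ℂ :=
  qPoch p (2 * N) * (qPochInv p (N + n) * qPochInv p (N - n))

lemma tripleCoeff_succ (hp : ‖p‖ < 1) (hp0 : p ≠ 0) (N : ℕ) (n : ℤ) :
    tripleCoeff p (N + 1) n = (1 + p ^ (2 * N + 1)) * tripleCoeff p N n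
      + p ^ (N + 1) * p ^ (-n) * tripleCoeff p N (n - 1)
      + p ^ N * p ^ (n + 1) * tripleCoeff p N (n + 1) := by
  have e1 := qPochInv_sub_one hp (N + 1 + n)
  have e2 := qPochInv_sub_one hp (N + n)
  have e3 := qPochInv_sub_one hp (N + 1 - n)
  have e4 := qPochInv_sub_one hp (N - n)
  rw [show (N : ℤ) + 1 + n - 1 = N + n by ring] at e1
  rw [show (N : ℤ) + 1 - n - 1 = N - n by ring] at e3
  have hr : qPoch p (2 * (N + 1)) = qPoch p (2 * N) * (1 - p ^ (2 * N + 1)) * (1 - p ^ (2 * N + 2)) := by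
    rw [show 2 * (N + 1) = 2 * N + 1 + 1 by ring, qPoch, qPoch, Finset.prod_range_succ,
      Finset.prod_range_succ]
  unfold tripleCoeff
  rw [hr]
  push_cast
  rw [show (N : ℤ) - (n - 1) = N + 1 - n by ring, show (N : ℤ) + (n - 1) = N + n - 1 by ring,
    show (N : ℤ) + (n + 1) = N + 1 + n by ring, show (N : ℤ) - (n + 1) = N - n - 1 by ring,
    e2, e4, e1, e3]
  simp only [zpow_add₀ hp0, zpow_sub₀ hp0, zpow_neg, zpow_natCast, zpow_one, pow_add, pow_mul',
    pow_one, pow_two]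
  have : p ^ n ≠ 0 := zpow_ne_zero _ hp0
  field_simp
  ring

/-- The finite triple product. -/
def tripleProd (p w : ℂ) (N : ℕ) : ℂ :=
  (∏ j ∈ Finset.range N, (1 - w * p ^ (j + 1))) * ∏ j ∈ Finset.range N, (1 - p ^ j / w)

lemma hasSum_tripleProd (hp : ‖p‖ < 1) (hp0 : p ≠ 0) (hw : w ≠ 0)
    (hT : ∀ n, w * T (n - 1) = -(p ^ (-n)) * T n) (N : ℕ) :
    HasSum (fun n => tripleCoeff p N n * T n) (tripleProd p w N * T 0) := by
  induction N with
  | zero =>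
    have : tripleProd p w 0 * T 0 = tripleCoeff p 0 0 * T 0 := by
      simp [tripleProd, tripleCoeff, qPoch, qPochInv]
    rw [this]
    refine hasSum_single 0 fun n hn => ?_
    have : qPochInv p n * qPochInv p (-n) = 0 := by
      rcases lt_or_gt_of_ne hn with h | h
      · rw [qPochInv, if_neg (by omega), zero_mul]
      · rw [mul_comm, qPochInv, if_neg (by omega), zero_mul]
    simp [tripleCoeff, this]
  | succ N ih =>
    have h1 := ih.mul_left (1 + p ^ (2 * N + 1))
    have h2 := (((Equiv.subRight (1 : ℤ)).hasSum_iff).2 ih).mul_left (-(w * p ^ (N + 1)))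
    have h3 := (((Equiv.addRight (1 : ℤ)).hasSum_iff).2 ih).mul_left (-(p ^ N / w))
    have h4 := (h1.add h2).add h3
    have e2 : tripleProd p w (N + 1) * T 0 = (1 + p ^ (2 * N + 1)) * (tripleProd p w N * T 0)
        + -(w * p ^ (N + 1)) * (tripleProd p w N * T 0)
        + -(p ^ N / w) * (tripleProd p w N * T 0) := by
      have : tripleProd p w (N + 1)
          = tripleProd p w N * ((1 - w * p ^ (N + 1)) * (1 - p ^ N / w)) := by
        unfold tripleProd
        rw [Finset.prod_range_succ, Finset.prod_range_succ]
        ring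
      rw [this]
      field_simp
      ring
    rw [e2]
    refine (funext fun n => ?_ : (fun n => tripleCoeff p (N + 1) n * T n) = _) ▸ h4
    have t1 := hT n
    have t2 : T (n + 1) / w = -(p ^ (n + 1)) * T n := by
      have := hT (n + 1)
      rw [add_sub_cancel_right, zpow_neg] at this
      have hz : p ^ (n + 1) ≠ 0 := zpow_ne_zero _ hp0
      field_simp at this ⊢
      linear_combination this
    simp only [Function.comp, Equiv.subRight_apply, Equiv.coe_addRight]
    rw [tripleCoeff_succ hp hp0]
    linear_combination p ^ (N + 1) * tripleCoeff p N (n - 1) * t1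
      + p ^ N * tripleCoeff p N (n + 1) * t2

lemma summable_norm_geom_mul (hp : ‖p‖ < 1) (c : ℂ) : Summable fun j : ℕ => ‖c * p ^ j‖ := by
  simp_rw [norm_mul, norm_pow]
  exact (summable_geometric_of_lt_one (norm_nonneg _) hp).mul_left _

lemma exists_tendsto_prod_one_add (hp : ‖p‖ < 1) (c : ℂ) (h : ∀ j : ℕ, 1 + c * p ^ j ≠ 0) :
    ∃ r ≠ 0, Tendsto (fun N => ∏ j ∈ Finset.range N, (1 + c * p ^ j)) atTop (𝓝 r) :=
  ⟨_, tprod_one_add_ne_zero_of_summable h (summable_norm_geom_mul hp c),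
    (multipliable_one_add_of_summable (summable_norm_geom_mul hp c)).hasProd.tendsto_prod_nat⟩

lemma exists_tendsto_qPoch (hp : ‖p‖ < 1) : ∃ r ≠ 0, Tendsto (qPoch p) atTop (𝓝 r) := by
  have h (j : ℕ) : 1 + (-p) * p ^ j = 1 - p ^ (j + 1) := by ring
  obtain ⟨r, hr, ht⟩ := exists_tendsto_prod_one_add hp (-p) fun j => by
    rw [h]; exact one_sub_pow_ne_zero hp j
  refine ⟨r, hr, ?_⟩
  exact ht.congr fun N => Finset.prod_congr rfl fun j _ => h j

lemma tsum_ne_zero_of_triple (hp : ‖p‖ < 1) (hp0 : p ≠ 0) (hw : w ≠ 0)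
    (hT : ∀ n, w * T (n - 1) = -(p ^ (-n)) * T n) (hs : Summable T) (hT0 : T 0 ≠ 0)
    (hwp : ∀ m : ℤ, w ≠ p ^ m) : ∑' n, T n ≠ 0 := by
  obtain ⟨r, hr, hrt⟩ := exists_tendsto_qPoch hp
  obtain ⟨r₁, hr₁, hrt₁⟩ := exists_tendsto_prod_one_add hp (-(w * p)) fun j h => by
    apply hwp (-(j + 1))
    rw [zpow_neg]
    refine eq_inv_of_mul_eq_one_left ?_
    rw [show (p ^ ((j : ℤ) + 1)) = p ^ (j + 1) by norm_cast]
    linear_combination -h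
  obtain ⟨r₂, hr₂, hrt₂⟩ := exists_tendsto_prod_one_add hp (-w⁻¹) fun j h => by
    apply hwp j
    rw [zpow_natCast]
    field_simp at h
    linear_combination h
  have hprod : Tendsto (fun N => tripleProd p w N * T 0) atTop (𝓝 (r₁ * r₂ * T 0)) := by
    refine ((hrt₁.mul hrt₂).mul_const _).congr fun N => ?_
    rw [tripleProd]
    congr 2 <;> exact Finset.prod_congr rfl fun j _ => by ring
  have hinv : Tendsto (qPochInv p) atTop (𝓝 r⁻¹) := by
    have h1 : Tendsto (fun n : ℤ => (qPoch p n.toNat)⁻¹) atTop (𝓝 r⁻¹) :=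
      (hrt.comp (show Tendsto (fun n : ℤ => n.toNat) atTop atTop from
        tendsto_atTop_atTop.2 fun b => ⟨b, fun a ha => by omega⟩)).inv₀ hr
    refine h1.congr' ?_
    filter_upwards [eventually_ge_atTop 0] with n hn
    rw [qPochInv, if_pos hn]
  have h2N : Tendsto (fun N : ℕ => qPoch p (2 * N)) atTop (𝓝 r) :=
    hrt.comp (tendsto_atTop_atTop.2 fun b => ⟨b, fun a ha => by omega⟩)
  obtain ⟨B₁, hB₁⟩ := (Metric.isBounded_range_of_tendsto _ hrt).exists_norm_le
  obtain ⟨B₂, hB₂⟩ := (Metric.isBounded_range_of_tendsto _ (hrt.inv₀ hr)).exists_norm_le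
  have hb1 (n : ℕ) : ‖qPoch p n‖ ≤ B₁ := hB₁ _ ⟨n, rfl⟩
  have hb2 (n : ℤ) : ‖qPochInv p n‖ ≤ B₂ := by
    have h0 : 0 ≤ B₂ := (norm_nonneg _).trans (hB₂ _ ⟨0, rfl⟩)
    unfold qPochInv
    split_ifs
    · exact hB₂ _ ⟨n.toNat, rfl⟩
    · simpa using h0
  have hsum : Tendsto (fun N => ∑' n, tripleCoeff p N n * T n) atTop
      (𝓝 (∑' n, r * (r⁻¹ * r⁻¹) * T n)) := by
    refine tendsto_tsum_of_dominated_convergence (bound := fun n => B₁ * (B₂ * B₂) * ‖T n‖)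
      (hs.norm.mul_left _) (fun n => ?_) (Eventually.of_forall fun N n => ?_)
    · refine (h2N.mul (Tendsto.mul ?_ ?_)).mul_const _
      · exact hinv.comp (tendsto_atTop_atTop.2 fun b => ⟨(b - n).toNat, fun a ha => by omega⟩)
      · exact hinv.comp (tendsto_atTop_atTop.2 fun b => ⟨(b + n).toNat, fun a ha => by omega⟩)
    · rw [norm_mul, tripleCoeff, norm_mul, norm_mul]
      have h0 : 0 ≤ B₂ := (norm_nonneg _).trans (hb2 0)
      have h1 : 0 ≤ B₁ := (norm_nonneg _).trans (hb1 0)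
      gcongr
      · exact hb1 _
      · exact hb2 _
      · exact hb2 _
  simp_rw [(hasSum_tripleProd hp hp0 hw hT _).tsum_eq] at hsum
  have := tendsto_nhds_unique hprod hsum
  rw [tsum_mul_left] at this
  intro h
  rw [h, mul_zero] at this
  exact mul_ne_zero (mul_ne_zero hr₁ hr₂) hT0 this

end TripleProduct

/-- The summand of `imTheta`. -/
def imThetaTerm (η : ℝ) (z : ℂ) (n : ℤ) : ℂ := (-1 : ℂ) ^ n *
  Complex.exp (-(((2 * (n : ℂ) + 1) / 2) ^ 2 * η) + (2 * (n : ℂ) + 1) * Complex.I * z)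

lemma imTheta_eq_tsum (η : ℝ) (z : ℂ) : imTheta η z = ∑' n : ℤ, imThetaTerm η z n := by
  rw [imTheta, jTheta]
  refine tsum_congr fun n => ?_
  rw [imThetaTerm, mul_assoc _ (Real.pi : ℂ), pi_mul_I_mul_div, mul_assoc _ Complex.I,
    ← mul_assoc Complex.I Complex.I, Complex.I_mul_I]
  congr 3
  ring

lemma summable_imThetaTerm {η : ℝ} (hη : 0 < η) (z : ℂ) : Summable (imThetaTerm η z) := by
  have hτ : 0 < (Complex.I * (η / Real.pi : ℝ) : ℂ).im := by simpa using div_pos hη Real.pi_pos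
  have hpi : (Real.pi : ℂ) ≠ 0 := Complex.ofReal_ne_zero.2 Real.pi_ne_zero
  have h := ((summable_jacobiTheta₂_term_iff (z / Real.pi + (Complex.I * (η / Real.pi : ℝ)) / 2 + 1 / 2)
    (Complex.I * (η / Real.pi : ℝ))).2 hτ).mul_left (Complex.exp (-η / 4 + Complex.I * z))
  refine h.congr fun n => ?_
  have h1 : (-1 : ℂ) ^ n = Complex.exp (n * (Real.pi * Complex.I)) := by
    rw [Complex.exp_int_mul, Complex.exp_pi_mul_I]
  rw [imThetaTerm, jacobiTheta₂_term, h1, ← Complex.exp_add, ← Complex.exp_add]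
  congr 1
  push_cast
  field_simp
  linear_combination ((η : ℂ) * n * 16 + n ^ 2 * η * 16) * Complex.I_sq

theorem exists_of_imTheta_eq_zero {η : ℝ} (hη : 0 < η) {z : ℂ} (hz : imTheta η z = 0) :
    ∃ m n : ℤ, z = m * Real.pi + n * (Complex.I * η) := by
  by_contra! hne
  rw [imTheta_eq_tsum] at hz
  refine tsum_ne_zero_of_triple (p := Complex.exp (-2 * η)) (w := Complex.exp (2 * Complex.I * z))
    ?_ (Complex.exp_ne_zero _) (Complex.exp_ne_zero _) (fun n => ?_) (summable_imThetaTerm hη z) ?_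
    (fun m hm => ?_) hz
  · rw [Complex.norm_exp, Real.exp_lt_one_iff]
    simpa using hη
  · have h1 : (-1 : ℂ) ^ n = -(-1) ^ (n - 1) := by
      rw [zpow_sub_one₀ (by norm_num)]; norm_num
    have h2 : Complex.exp (2 * Complex.I * z) *
        Complex.exp (-(((2 * ((n - 1 : ℤ) : ℂ) + 1) / 2) ^ 2 * η)
          + (2 * ((n - 1 : ℤ) : ℂ) + 1) * Complex.I * z) =
        Complex.exp (((-n : ℤ) : ℂ) * (-2 * η)) * Complex.exp (-(((2 * (n : ℂ) + 1) / 2) ^ 2 * η)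
          + (2 * (n : ℂ) + 1) * Complex.I * z) := by
      rw [← Complex.exp_add, ← Complex.exp_add]
      congr 1
      push_cast
      ring
    rw [imThetaTerm, imThetaTerm, h1, ← Complex.exp_int_mul]
    linear_combination (-1 : ℂ) ^ (n - 1) * h2
  · exact mul_ne_zero (zpow_ne_zero _ (by norm_num)) (Complex.exp_ne_zero _)
  · rw [← Complex.exp_int_mul, Complex.exp_eq_exp_iff_exists_int] at hm
    obtain ⟨k, hk⟩ := hm
    apply hne k m
    have : (2 * Complex.I) * z = (2 * Complex.I) * (k * Real.pi + m * (Complex.I * η)) := by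
      linear_combination hk - 2 * m * η * Complex.I_sq
    exact mul_left_cancel₀ (mul_ne_zero two_ne_zero Complex.I_ne_zero) this

lemma imTheta_ne_zero_of_im {η : ℝ} (hη : 0 < η) {z : ℂ} (h0 : 0 < |z.im|) (h1 : |z.im| < η) :
    imTheta η z ≠ 0 := by
  intro h
  obtain ⟨m, n, rfl⟩ := exists_of_imTheta_eq_zero hη h
  have him : ((m : ℂ) * Real.pi + n * (Complex.I * η)).im = n * η := by simp
  rw [him, abs_mul, abs_of_pos hη] at h0 h1
  have hn : |(n : ℝ)| < 1 := by
    by_contra! h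
    nlinarith
  have : n = 0 := by
    have h2 : |n| < 1 := by exact_mod_cast hn
    exact Int.abs_lt_one_iff.1 h2
  simp [this] at h0

/-- A doubly periodic function is bounded if it is continuous. -/
lemma isBounded_range_of_periodic {η : ℝ} (hη : 0 < η) {g : ℂ → ℂ} (hg : Continuous g)
    (h1 : Function.Periodic g (Real.pi : ℂ)) (h2 : Function.Periodic g (Complex.I * η)) :
    Bornology.IsBounded (Set.range g) := by
  have hK : IsCompact (Set.Icc 0 Real.pi ×ℂ Set.Icc 0 η) := isCompact_Icc.reProdIm isCompact_Icc
  refine (hK.image hg).isBounded.subset ?_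
  rintro _ ⟨z, rfl⟩
  obtain ⟨m, hm, -⟩ := existsUnique_add_zsmul_mem_Ico Real.pi_pos z.re 0
  obtain ⟨n, hn, -⟩ := existsUnique_add_zsmul_mem_Ico hη z.im 0
  refine ⟨z + m * Real.pi + n * (Complex.I * η), ?_, ?_⟩
  · rw [Complex.mem_reProdIm]
    simp only [zsmul_eq_mul, zero_add] at hm hn
    constructor
    · have : (z + m * Real.pi + n * (Complex.I * η)).re = z.re + m * Real.pi := by simp
      rw [this]; exact Set.Ico_subset_Icc_self hm
    · have : (z + m * Real.pi + n * (Complex.I * η)).im = z.im + n * η := by simp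
      rw [this]; exact Set.Ico_subset_Icc_self hn
  · rw [h2.int_mul n, h1.int_mul m]

lemma eq_zero_of_quasiPeriodic {η : ℝ} (hη : 0 < η) {N M φ : ℂ → ℂ} {c : ℂ}
    (hN : Differentiable ℂ N) (hM : Differentiable ℂ M) (hc : c ≠ 0) (hφ : ∀ z, φ z ≠ 0)
    (hN1 : ∀ z, N (z + Real.pi) = c * N z) (hM1 : ∀ z, M (z + Real.pi) = c * M z)
    (hN2 : ∀ z, N (z + Complex.I * η) = φ z * N z) (hM2 : ∀ z, M (z + Complex.I * η) = φ z * M z)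
    (hz : ∀ z, M z = 0 → ∃ m n : ℤ, z = m * Real.pi + n * (Complex.I * η))
    (hN0 : N 0 = 0) (hM0 : M 0 = 0) (hN' : deriv N 0 = 0) (hM' : deriv M 0 ≠ 0) (z : ℂ) :
    N z = 0 := by
  have p1 : Function.Periodic (fun z => N z / M z) (Real.pi : ℂ) := fun z => by
    simp only [hN1, hM1]; exact mul_div_mul_left _ _ hc
  have p2 : Function.Periodic (fun z => N z / M z) (Complex.I * η) := fun z => by
    simp only [hN2, hM2]; exact mul_div_mul_left _ _ (hφ z)
  have hcount : {z | M z = 0}.Countable := by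
    refine (Set.countable_range fun q : ℤ × ℤ =>
      ((q.1 : ℂ) * Real.pi + q.2 * (Complex.I * η))).mono fun z h => ?_
    obtain ⟨m, n, h⟩ := hz z h
    exact ⟨(m, n), h.symm⟩
  have hc0 : ContinuousAt (fun z => N z / M z) 0 := by
    rw [continuousAt_iff_punctured_nhds]
    have s1 := hasDerivAt_iff_tendsto_slope.1 (hN 0).hasDerivAt
    have s2 := hasDerivAt_iff_tendsto_slope.1 (hM 0).hasDerivAt
    have := s1.div s2 hM'
    simp only [hN', hM0, zero_div, div_zero] at this ⊢
    refine this.congr' ?_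
    filter_upwards [self_mem_nhdsWithin] with z (h : z ≠ 0)
    simp only [Pi.div_apply, slope_def_field, hN0, hM0, sub_zero]
    exact div_div_div_cancel_right₀ h _ _
  have hcont : Continuous fun z => N z / M z := by
    refine continuous_iff_continuousAt.2 fun z => ?_
    by_cases h : M z = 0
    · obtain ⟨m, n, rfl⟩ := hz z h
      have : (fun z => N z / M z) = fun z =>
          (fun z => N z / M z) (z - (m * Real.pi + n * (Complex.I * η))) := by
        funext w
        rw [← (p1.int_mul m) (w - _), ← (p2.int_mul n)]
        congr 1 <;> ring_nf
      rw [this]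
      refine ContinuousAt.comp' (f := fun z : ℂ => z - (m * Real.pi + n * (Complex.I * η)))
        (g := fun z => N z / M z) ?_ (by fun_prop)
      rwa [sub_self]
    · exact (hN z).continuousAt.div (hM z).continuousAt h
  have hdiff : Differentiable ℂ fun z => N z / M z := fun z => by
    have := Complex.hasFPowerSeriesOnBall_of_differentiable_off_countable (c := z) (R := 1) hcount
      hcont.continuousOn (fun w hw => (hN w).div (hM w) hw.2) one_pos
    exact this.differentiableOn.differentiableAt (Metric.eball_mem_nhds _ (by simp))
  have hzero (w : ℂ) : N w / M w = 0 := by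
    have := hdiff.apply_eq_apply_of_bounded (isBounded_range_of_periodic hη hcont p1 p2) w 0
    simpa [hN0] using this
  have : N = fun _ => 0 := by
    refine Continuous.ext_on (hcount.dense_compl ℝ) hN.continuous continuous_const fun w hw => ?_
    exact (div_eq_zero_iff.1 (hzero w)).resolve_right hw
  exact congrFun this z

section Kernel

variable {η : ℝ}

lemma three_mul_pos_of_pos (hη : 0 < η) : 0 < 3 * η := by positivity

lemma imTheta_add_two_mul (η : ℝ) (z : ℂ) :
    imTheta (3 * η) (z + Complex.I * η + Complex.I * η) =
      -Complex.exp (-2 * Complex.I * z + η) * imTheta (3 * η) (z - Complex.I * η) := by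
  have h := imTheta_add_I_mul (3 * η) (z - Complex.I * η)
  rw [show z - Complex.I * η + Complex.I * ((3 * η : ℝ) : ℂ)
    = z + Complex.I * η + Complex.I * η by push_cast; ring] at h
  rw [h]
  congr 3
  push_cast
  linear_combination 2 * η * Complex.I_sq

lemma deriv_imTheta_neg (hη : 0 < η) (z : ℂ) :
    deriv (imTheta η) (-z) = deriv (imTheta η) z := by
  have h1 := ((differentiable_imTheta hη (-z)).hasDerivAt.scomp z (hasDerivAt_neg z)).deriv
  have h2 : imTheta η ∘ Neg.neg = -imTheta η := funext fun z => imTheta_neg η z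
  rw [h2, deriv.neg'] at h1
  simpa using h1.symm

lemma exp_two_I_mul_add (η : ℝ) (z : ℂ) : Complex.exp (2 * Complex.I * (z + Complex.I * η)) =
    Complex.exp (2 * Complex.I * z) * (Complex.exp (η / 3) ^ 6)⁻¹ := by
  rw [← Complex.exp_nat_mul, ← Complex.exp_neg, ← Complex.exp_add]
  congr 1
  push_cast
  linear_combination 2 * η * Complex.I_sq

lemma exp_neg_two_I_mul (z : ℂ) :
    Complex.exp (-2 * Complex.I * z) = (Complex.exp (2 * Complex.I * z))⁻¹ := by
  rw [← Complex.exp_neg]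
  congr 1
  ring

lemma exp_eq_exp_third_pow (η : ℝ) : Complex.exp η = Complex.exp (η / 3) ^ 3 := by
  rw [← Complex.exp_nat_mul]
  congr 1
  push_cast
  ring

lemma exp_two_I_mul_add_pi (z : ℂ) :
    Complex.exp (2 * Complex.I * (z + Real.pi)) = Complex.exp (2 * Complex.I * z) := by
  rw [mul_add, show 2 * Complex.I * (Real.pi : ℂ) = 2 * Real.pi * Complex.I by ring,
    Complex.exp_periodic]

/-- The value of the generating-function variable `t` in terms of theta functions. -/
def cellVar (η : ℝ) : ℂ := Complex.exp (η / 3) * deriv (imTheta (3 * η)) 0 /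
  (4 * Complex.I * imTheta (3 * η) (Complex.I * η) + 6 * deriv (imTheta (3 * η)) (Complex.I * η))

lemma imTheta_three_ne_zero (hη : 0 < η) : imTheta (3 * η) (Complex.I * η) ≠ 0 := by
  refine imTheta_ne_zero_of_im (three_mul_pos_of_pos hη) ?_ ?_
  · simpa using hη.ne'
  · simp [abs_of_pos hη]; linarith

lemma deriv_imTheta_ne_zero (ht : cellVar η ≠ 0) : deriv (imTheta (3 * η)) 0 ≠ 0 := by
  rintro h
  exact ht (by simp [cellVar, h])

/-- The cubic relation between the three translates of the theta function by a third period. -/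
theorem imTheta_cubic (hη : 0 < η) (ht : cellVar η ≠ 0) (z : ℂ) :
    cellVar η * (Complex.exp (η / 3) ^ 2 * imTheta (3 * η) z ^ 3 - (Complex.exp (η / 3))⁻¹ *
      (Complex.exp (2 * Complex.I * z) * imTheta (3 * η) (z + Complex.I * η) ^ 3 +
        Complex.exp (-2 * Complex.I * z) * imTheta (3 * η) (z - Complex.I * η) ^ 3)) =
    imTheta (3 * η) z * imTheta (3 * η) (z + Complex.I * η) *
      imTheta (3 * η) (z - Complex.I * η) := by
  have h3 := three_mul_pos_of_pos hη
  have hd := differentiable_imTheta h3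
  have hΘ0 := imTheta_zero (3 * η)
  have hw0 : imTheta (3 * η) (0 - Complex.I * η) = -imTheta (3 * η) (Complex.I * η) := by
    rw [zero_sub, imTheta_neg]
  have hu := (hd 0).hasDerivAt
  have hv := ((hd (0 + Complex.I * η)).hasDerivAt.comp_add_const 0 (Complex.I * η))
  have hw := ((hd (0 - Complex.I * η)).hasDerivAt.comp_sub_const 0 (Complex.I * η))
  rw [zero_sub, deriv_imTheta_neg h3] at hw
  rw [zero_add] at hv
  have he (c : ℂ) : HasDerivAt (fun z => Complex.exp (c * z)) (c * Complex.exp (c * 0)) 0 := by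
    simpa [mul_comm] using ((hasDerivAt_id (0 : ℂ)).const_mul c).cexp
  have hM' : HasDerivAt (fun z => imTheta (3 * η) z * imTheta (3 * η) (z + Complex.I * η) *
      imTheta (3 * η) (z - Complex.I * η))
      (-(deriv (imTheta (3 * η)) 0 * imTheta (3 * η) (Complex.I * η) ^ 2)) 0 := by
    refine ((hu.mul hv).mul hw).congr_deriv ?_
    simp only [Pi.mul_apply, hw0, hΘ0, zero_add]
    ring
  have hN' := (((hu.pow 3).const_mul (Complex.exp (η / 3) ^ 2)).sub
    ((((he (2 * Complex.I)).mul (hv.pow 3)).add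
      ((he (-2 * Complex.I)).mul (hw.pow 3))).const_mul (Complex.exp (η / 3))⁻¹)).const_mul
    (cellVar η)
  have hden : cellVar η * (4 * Complex.I * imTheta (3 * η) (Complex.I * η)
      + 6 * deriv (imTheta (3 * η)) (Complex.I * η))
      = Complex.exp (η / 3) * deriv (imTheta (3 * η)) 0 := by
    refine div_mul_cancel₀ _ fun h => ht ?_
    rw [cellVar, h, div_zero]
  have hp0 : Complex.exp (η / 3) ≠ 0 := Complex.exp_ne_zero _
  have hV := imTheta_three_ne_zero hη
  have hdiff := hN'.sub hM'
  rw [← sub_eq_zero]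
  refine eq_zero_of_quasiPeriodic hη (c := -1) (φ := fun z => -Complex.exp (-2 * Complex.I * z + η))
    (N := fun z => cellVar η * (Complex.exp (η / 3) ^ 2 * imTheta (3 * η) z ^ 3 -
      (Complex.exp (η / 3))⁻¹ *
      (Complex.exp (2 * Complex.I * z) * imTheta (3 * η) (z + Complex.I * η) ^ 3 +
        Complex.exp (-2 * Complex.I * z) * imTheta (3 * η) (z - Complex.I * η) ^ 3)) -
      imTheta (3 * η) z * imTheta (3 * η) (z + Complex.I * η) *
      imTheta (3 * η) (z - Complex.I * η))
    (M := fun z => imTheta (3 * η) z * imTheta (3 * η) (z + Complex.I * η) *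
      imTheta (3 * η) (z - Complex.I * η))
    (by fun_prop) (by fun_prop) (by norm_num) (fun z => neg_ne_zero.2 (Complex.exp_ne_zero _))
    ?_ ?_ ?_ ?_ ?_ ?_ ?_ ?_ ?_ z
  · intro z
    simp only [exp_neg_two_I_mul, exp_two_I_mul_add_pi, add_right_comm z _ (Complex.I * (η : ℂ)),
      add_sub_right_comm, imTheta_add_pi]
    ring
  · intro z
    simp only [add_right_comm z _ (Complex.I * (η : ℂ)), add_sub_right_comm, imTheta_add_pi]
    ring
  · intro z
    have hE : Complex.exp (2 * Complex.I * z) ≠ 0 := Complex.exp_ne_zero _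
    simp only [imTheta_add_two_mul, add_sub_cancel_right, Complex.exp_add, exp_neg_two_I_mul,
      exp_two_I_mul_add, exp_eq_exp_third_pow η]
    field_simp
    ring
  · intro z
    simp only [imTheta_add_two_mul, add_sub_cancel_right]
    ring
  · intro z hz
    rcases mul_eq_zero.1 hz with hz | hz
    · rcases mul_eq_zero.1 hz with hz | hz
      · obtain ⟨m, n, h⟩ := exists_of_imTheta_eq_zero h3 hz
        exact ⟨m, 3 * n, by rw [h]; push_cast; ring⟩
      · obtain ⟨m, n, h⟩ := exists_of_imTheta_eq_zero h3 hz
        exact ⟨m, 3 * n - 1, by rw [eq_sub_of_add_eq h]; push_cast; ring⟩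
    · obtain ⟨m, n, h⟩ := exists_of_imTheta_eq_zero h3 hz
      exact ⟨m, 3 * n + 1, by rw [eq_add_of_sub_eq h]; push_cast; ring⟩
  · simp only [hw0, hΘ0, zero_add, mul_zero, Complex.exp_zero]
    ring
  · simp [hΘ0]
  · refine hdiff.deriv.trans ?_
    simp only [Pi.pow_apply, hw0, hΘ0, zero_add, mul_zero, Complex.exp_zero]
    clear hdiff hN' hM'
    generalize imTheta (3 * η) (Complex.I * η) = V at *
    generalize deriv (imTheta (3 * η)) (Complex.I * η) = V' at *
    field_simp
    norm_num
    linear_combination -V ^ 2 * hden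
  · rw [hM'.deriv]
    exact neg_ne_zero.2 (mul_ne_zero (deriv_imTheta_ne_zero ht) (pow_ne_zero _ hV))

/-- The uniformisation of the kernel curve. -/
def kerX (η : ℝ) (z : ℂ) : ℂ := -(Complex.exp (η / 3) * Complex.exp (-2 * Complex.I * z) *
  imTheta (3 * η) z * imTheta (3 * η) (z - Complex.I * η) /
  imTheta (3 * η) (z + Complex.I * η) ^ 2)

lemma imTheta_neg_add (η : ℝ) (z c : ℂ) : imTheta η (-z + c) = -imTheta η (z - c) := by
  rw [← imTheta_neg]
  congr 1
  ring

lemma imTheta_neg_sub (η : ℝ) (z c : ℂ) : imTheta η (-z - c) = -imTheta η (z + c) := by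
  rw [← imTheta_neg]
  congr 1
  ring

lemma kerX_neg (η : ℝ) (z : ℂ) : kerX η (-z) =
    -(Complex.exp (η / 3) * Complex.exp (2 * Complex.I * z) *
      imTheta (3 * η) z * imTheta (3 * η) (z + Complex.I * η) /
      imTheta (3 * η) (z - Complex.I * η) ^ 2) := by
  rw [kerX, imTheta_neg_add, imTheta_neg_sub, imTheta_neg]
  ring_nf

lemma kerX_add_I_mul (η : ℝ) (z : ℂ) : kerX η (z + Complex.I * η) = kerX η (-z) := by
  have hE : Complex.exp (2 * Complex.I * z) ≠ 0 := Complex.exp_ne_zero _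
  have hp0 : Complex.exp (η / 3) ≠ 0 := Complex.exp_ne_zero _
  rw [kerX_neg, kerX]
  simp only [imTheta_add_two_mul, add_sub_cancel_right, Complex.exp_add, exp_neg_two_I_mul,
      exp_two_I_mul_add, exp_eq_exp_third_pow η]
  field_simp

lemma kerX_add_pi (η : ℝ) (z : ℂ) : kerX η (z + Real.pi) = kerX η z := by
  rw [kerX, kerX]
  simp only [exp_neg_two_I_mul, exp_two_I_mul_add_pi, add_right_comm z _ (Complex.I * (η : ℂ)),
      add_sub_right_comm, imTheta_add_pi]
  ring

lemma kerX_zero (η : ℝ) : kerX η 0 = 0 := by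
  simp [kerX, imTheta_zero]

lemma conj_kerX (η : ℝ) (x : ℝ) : (starRingEnd ℂ) (kerX η x) = kerX η (-x) := by
  rw [kerX_neg, kerX]
  simp only [map_neg, map_mul, map_div₀, map_pow, conj_imTheta, ← Complex.exp_conj, map_sub,
    map_add, Complex.conj_I, Complex.conj_ofReal, map_ofNat]
  ring_nf

lemma kerX_mul_kerX_neg (η : ℝ) (z : ℂ) : kerX η z * kerX η (-z) = Complex.exp (η / 3) ^ 2 *
    imTheta (3 * η) z ^ 2 /
      (imTheta (3 * η) (z + Complex.I * η) * imTheta (3 * η) (z - Complex.I * η)) := by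
  have hE : Complex.exp (2 * Complex.I * z) ≠ 0 := Complex.exp_ne_zero _
  rw [kerX_neg, kerX, exp_neg_two_I_mul]
  field_simp

lemma kerX_kernel {z : ℂ} (hη : 0 < η) (ht : cellVar η ≠ 0) (hu : imTheta (3 * η) z ≠ 0)
    (hv : imTheta (3 * η) (z + Complex.I * η) ≠ 0)
    (hw : imTheta (3 * η) (z - Complex.I * η) ≠ 0) : cellVar η *
    (kerX η z * kerX η (-z) + 1 / kerX η z + 1 / kerX η (-z)) = 1 := by
  have hE : Complex.exp (2 * Complex.I * z) ≠ 0 := Complex.exp_ne_zero _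
  have hp0 : Complex.exp (η / 3) ≠ 0 := Complex.exp_ne_zero _
  have h := imTheta_cubic hη ht z
  rw [kerX_mul_kerX_neg, kerX_neg, kerX]
  rw [exp_neg_two_I_mul] at h ⊢
  generalize imTheta (3 * η) (z + Complex.I * η) = v at *
  generalize imTheta (3 * η) (z - Complex.I * η) = w at *
  field_simp at h ⊢
  linear_combination h

end Kernel

section Bounds

variable {η r : ℝ}

lemma imTheta_add_ne_zero (hη : 0 < η) {z : ℂ} (h0 : -η < z.im) (h1 : z.im < 2 * η) :
    imTheta (3 * η) (z + Complex.I * η) ≠ 0 := by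
  have : (z + Complex.I * η).im = z.im + η := by simp
  apply imTheta_ne_zero_of_im (three_mul_pos_of_pos hη) <;> rw [this, abs_of_pos (by linarith)] <;>
    linarith

lemma imTheta_sub_ne_zero (hη : 0 < η) {z : ℂ} (h0 : -(2 * η) < z.im) (h1 : z.im < η) :
    imTheta (3 * η) (z - Complex.I * η) ≠ 0 := by
  have : (z - Complex.I * η).im = z.im - η := by simp
  apply imTheta_ne_zero_of_im (three_mul_pos_of_pos hη) <;> rw [this, abs_of_neg (by linarith)] <;>
    linarith

lemma differentiableAt_kerX (hη : 0 < η) {z : ℂ} (h0 : -η < z.im) (h1 : z.im < 2 * η) :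
    DifferentiableAt ℂ (kerX η) z := by
  have hd := differentiable_imTheta (three_mul_pos_of_pos hη)
  unfold kerX
  have := pow_ne_zero 2 (imTheta_add_ne_zero hη h0 h1)
  fun_prop (disch := assumption)

lemma exists_periodic_re_mem {f : ℂ → ℂ} (hf : ∀ z, f (z + Real.pi) = f z) (z : ℂ) :
    ∃ w : ℂ, w.re ∈ Set.Icc 0 Real.pi ∧ w.im = z.im ∧ f w = f z := by
  obtain ⟨m, hm, -⟩ := existsUnique_add_zsmul_mem_Ico Real.pi_pos z.re 0
  refine ⟨z + m * Real.pi, ?_, by simp, Function.Periodic.int_mul hf m z⟩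
  simp only [zsmul_eq_mul, zero_add] at hm
  have : (z + m * Real.pi).re = z.re + m * Real.pi := by simp
  rw [this]; exact Set.Ico_subset_Icc_self hm

lemma norm_kerX_ofReal_lt_one (hη : 0 < η) (hr : cellVar η = r) (hr0 : 0 < r) (hr1 : r < 1 / 3)
    (x : ℝ) : ‖kerX η x‖ < 1 := by
  have hne (x : ℝ) : ‖kerX η x‖ ≠ 1 := by
    intro h
    have ht : cellVar η ≠ 0 := by rw [hr]; exact_mod_cast hr0.ne'
    have hX : kerX η x ≠ 0 := by
      rw [← norm_ne_zero_iff, h]; exact one_ne_zero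
    have hu : imTheta (3 * η) x ≠ 0 := fun h => hX (by simp [kerX, h])
    have hk := kerX_kernel hη ht hu (imTheta_add_ne_zero hη (by simpa using hη) (by simpa using hη))
      (imTheta_sub_ne_zero hη (by simpa using hη) (by simpa using hη))
    have h2 : kerX η x * (starRingEnd ℂ) (kerX η x) = 1 := by
      rw [Complex.mul_conj, Complex.normSq_eq_norm_sq, h]; norm_num
    rw [← conj_kerX, h2, hr, one_div, one_div, inv_eq_of_mul_eq_one_right h2,
      inv_eq_of_mul_eq_one_left h2, add_assoc, add_comm ((starRingEnd ℂ) _), Complex.add_conj] at hk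
    have hk' : r * (1 + 2 * (kerX η x).re) = 1 := by exact_mod_cast hk
    have := (Complex.re_le_norm (kerX η x)).trans_eq h
    nlinarith
  by_contra! hge
  have hc : Continuous fun x : ℝ => ‖kerX η x‖ := by
    refine (continuous_iff_continuousAt.2 fun x => ?_).norm
    exact ContinuousAt.comp (f := ((↑) : ℝ → ℂ)) (differentiableAt_kerX hη (by simpa using hη)
      (by simpa using hη)).continuousAt Complex.continuous_ofReal.continuousAt
  obtain ⟨y, hy⟩ := mem_range_of_exists_le_of_exists_ge hc
    ⟨0, by simp [kerX_zero]⟩ ⟨x, hge⟩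
  exact hne y hy

lemma exists_norm_kerX_ofReal_le (hη : 0 < η) (hr : cellVar η = r) (hr0 : 0 < r) (hr1 : r < 1 / 3) :
    ∃ ρ < 1, ∀ x : ℝ, ‖kerX η x‖ ≤ ρ := by
  have hc : Continuous fun x : ℝ => ‖kerX η x‖ := by
    refine (continuous_iff_continuousAt.2 fun x => ?_).norm
    exact ContinuousAt.comp (f := ((↑) : ℝ → ℂ)) (differentiableAt_kerX hη (by simpa using hη)
      (by simpa using hη)).continuousAt Complex.continuous_ofReal.continuousAt
  obtain ⟨y, -, hy⟩ := isCompact_Icc.exists_isMaxOn (Set.nonempty_Icc.2 Real.pi_pos.le)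
    hc.continuousOn
  refine ⟨‖kerX η y‖, norm_kerX_ofReal_lt_one hη hr hr0 hr1 y, fun x => ?_⟩
  obtain ⟨w, hw, him, h⟩ := exists_periodic_re_mem (kerX_add_pi η) x
  have : w = (w.re : ℝ) := by apply Complex.ext <;> simp [him]
  rw [← h, this]
  exact hy hw

lemma norm_kerX_lt_one_of_im_mem (hη : 0 < η) (hr : cellVar η = r) (hr0 : 0 < r) (hr1 : r < 1 / 3)
    {z : ℂ} (h0 : 0 ≤ z.im) (h1 : z.im ≤ η) : ‖kerX η z‖ < 1 := by
  obtain ⟨ρ, hρ, hρX⟩ := exists_norm_kerX_ofReal_le hη hr hr0 hr1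
  refine lt_of_le_of_lt ?_ hρ
  have hdiff (z : ℂ) (hz : z ∈ Complex.im ⁻¹' Set.Icc 0 η) : DifferentiableAt ℂ (kerX η) z :=
    differentiableAt_kerX hη (by linarith [hz.1]) (by linarith [hz.2])
  have hcl : closure (Complex.im ⁻¹' Set.Ioo 0 η) = Complex.im ⁻¹' Set.Icc 0 η := by
    rw [Complex.closure_preimage_im, closure_Ioo hη.ne]
  obtain ⟨C, hC⟩ := ((isCompact_Icc.reProdIm isCompact_Icc :
    IsCompact (Set.Icc 0 Real.pi ×ℂ Set.Icc 0 η)).image_of_continuousOn fun z hz =>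
      (hdiff z hz.2).continuousAt.continuousWithinAt).isBounded.exists_norm_le
  have hbound (z : ℂ) (hz : z ∈ Complex.im ⁻¹' Set.Icc 0 η) : ‖kerX η z‖ ≤ C := by
    obtain ⟨w, hw, him, h⟩ := exists_periodic_re_mem (kerX_add_pi η) z
    rw [← h]
    exact hC _ ⟨w, ⟨hw, by rw [Set.mem_preimage, him]; exact hz⟩, rfl⟩
  refine PhragmenLindelof.horizontal_strip (a := 0) (b := η) ?_ ⟨0, ?_, 0, ?_⟩ ?_ ?_ h0 h1
  · refine DifferentiableOn.diffContOnCl fun z hz => ?_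
    rw [hcl] at hz
    exact (hdiff z hz).differentiableWithinAt
  · exact div_pos Real.pi_pos (by linarith)
  · refine Asymptotics.IsBigO.of_bound C ?_
    refine Filter.Eventually.filter_mono inf_le_right ?_
    refine Filter.eventually_principal.2 fun z hz => ?_
    simpa using hbound z (Set.Ioo_subset_Icc_self hz)
  · intro z hz
    have : z = (z.re : ℝ) := by apply Complex.ext <;> simp [hz]
    rw [this]
    exact hρX _
  · intro z hz
    have : z = ((-z.re : ℝ) : ℂ) * (-1) + Complex.I * η := by
      apply Complex.ext <;> simp [hz]
    rw [this, kerX_add_I_mul, mul_neg_one, neg_neg]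
    exact hρX _

theorem exists_norm_kerX_lt_one (hη : 0 < η) (hr : cellVar η = r) (hr0 : 0 < r) (hr1 : r < 1 / 3) :
    ∃ δ, 0 < δ ∧ δ < η ∧ ∀ z : ℂ, -δ ≤ z.im → z.im ≤ η → ‖kerX η z‖ < 1 := by
  have hdiff (z : ℂ) (hz : z ∈ Complex.im ⁻¹' Set.Ioo (-η) η) : DifferentiableAt ℂ (kerX η) z :=
    differentiableAt_kerX hη (by linarith [hz.1]) (by linarith [hz.2])
  have hopen : IsOpen (Complex.im ⁻¹' Set.Ioo (-η) η ∩ kerX η ⁻¹' Metric.ball 0 1) :=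
    ContinuousOn.isOpen_inter_preimage
      (fun z hz => (hdiff z hz).continuousAt.continuousWithinAt)
      (isOpen_Ioo.preimage Complex.continuous_im) Metric.isOpen_ball
  have hK : IsCompact (((↑) : ℝ → ℂ) '' Set.Icc 0 Real.pi) :=
    isCompact_Icc.image Complex.continuous_ofReal
  obtain ⟨ε, hε, hsub⟩ := hK.exists_thickening_subset_open hopen (by
    rintro _ ⟨x, -, rfl⟩
    refine ⟨by simpa using hη, ?_⟩
    simpa using norm_kerX_ofReal_lt_one hη hr hr0 hr1 x)
  refine ⟨min (ε / 2) (η / 2), by positivity, ?_, fun z h0 h1 => ?_⟩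
  · exact (min_le_right _ _).trans_lt (by linarith)
  · rcases le_or_gt 0 z.im with h | h
    · exact norm_kerX_lt_one_of_im_mem hη hr hr0 hr1 h h1
    · obtain ⟨w, hw, him, hX⟩ := exists_periodic_re_mem (kerX_add_pi η) z
      rw [← hX]
      have : w ∈ Metric.thickening ε (((↑) : ℝ → ℂ) '' Set.Icc 0 Real.pi) := by
        refine Metric.mem_thickening_iff.2 ⟨_, ⟨w.re, hw, rfl⟩, ?_⟩
        have e : w - w.re = Complex.I * (w.im : ℝ) := by apply Complex.ext <;> simp
        rw [dist_eq_norm, e, norm_mul, Complex.norm_I, one_mul, Complex.norm_real, Real.norm_eq_abs,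
          him, abs_of_neg h]
        have := min_le_left (ε / 2) (η / 2)
        linarith
      simpa using (hsub this).2

end Bounds

section Residue

lemma im_mul_integral_pos {f : ℝ → ℂ} {a b : ℝ} (hab : a < b) (hf : Continuous f) (c : ℂ)
    (h : ∀ s, 0 < (c * f s).im) : 0 < (c * ∫ s in a..b, f s).im := by
  have hc : Continuous fun s => c * f s := by fun_prop
  rw [← intervalIntegral.integral_const_mul]
  have := Complex.imCLM.intervalIntegral_comp_comm
    (hc.intervalIntegrable (μ := MeasureTheory.volume) a b)
  simp only [Complex.imCLM_apply] at this
  rw [← this]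
  exact intervalIntegral.intervalIntegral_pos_of_pos
    ((Complex.continuous_im.comp hc).intervalIntegrable a b) h hab

lemma mul_integral_inv_sq {p e : ℂ} {a b : ℝ} (h : ∀ s : ℝ, p + s * e ≠ 0) :
    e * ∫ s in a..b, ((p + s * e) ^ 2)⁻¹ = (p + a * e)⁻¹ - (p + b * e)⁻¹ := by
  rw [← intervalIntegral.integral_const_mul]
  have hd (s : ℝ) : HasDerivAt (fun s : ℝ => -(p + s * e)⁻¹) (e * ((p + s * e) ^ 2)⁻¹) s := by
    have h1 : HasDerivAt (fun s : ℝ => p + s * e) e s := by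
      simpa using ((Complex.ofRealCLM.hasDerivAt (x := s)).mul_const e).const_add p
    refine (h1.inv (h s)).neg.congr_deriv ?_
    rw [neg_div, neg_neg, div_eq_mul_inv]
  have hc : Continuous fun s : ℝ => e * ((p + s * e) ^ 2)⁻¹ := by
    have := fun s => pow_ne_zero 2 (h s)
    fun_prop (disch := assumption)
  rw [intervalIntegral.integral_eq_sub_of_hasDerivAt (fun s _ => hd s) (hc.intervalIntegrable a b)]
  ring

lemma integral_laurent {g : ℂ → ℂ} {S : Set ℂ} (hg : ContinuousOn g S) {p e w₀ w₁ : ℂ} {a b : ℝ}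
    (h : ∀ s : ℝ, p + s * e ≠ 0) (hS : ∀ s ∈ Set.uIcc a b, p + s * e ∈ S) {F : ℂ → ℂ}
    (hF : ∀ z ∈ S, z ≠ 0 → F z = w₀ * (z ^ 2)⁻¹ + w₁ * z⁻¹ + g z) :
    ∫ s in a..b, F (p + s * e) = w₀ * (∫ s in a..b, ((p + s * e) ^ 2)⁻¹) +
      w₁ * (∫ s in a..b, (p + s * e)⁻¹) + ∫ s in a..b, g (p + s * e) := by
  have hc1 : Continuous fun s : ℝ => w₀ * ((p + s * e) ^ 2)⁻¹ := by
    have := fun s => pow_ne_zero 2 (h s)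
    fun_prop (disch := assumption)
  have hc2 : Continuous fun s : ℝ => w₁ * (p + s * e)⁻¹ := by
    fun_prop (disch := assumption)
  have hc12 : Continuous fun s : ℝ => w₀ * ((p + s * e) ^ 2)⁻¹ + w₁ * (p + s * e)⁻¹ := hc1.add hc2
  have hc3 : ContinuousOn (fun s : ℝ => g (p + s * e)) (Set.uIcc a b) :=
    hg.comp (by fun_prop) hS
  rw [intervalIntegral.integral_congr fun s hs => hF _ (hS s hs) (h s),
    intervalIntegral.integral_add (hc12.intervalIntegrable a b) hc3.intervalIntegrable,
    intervalIntegral.integral_add (hc1.intervalIntegrable a b) (hc2.intervalIntegrable a b),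
    intervalIntegral.integral_const_mul, intervalIntegral.integral_const_mul]

variable {x y₁ y₂ : ℝ}

/-- The residue at the origin of a function with equal values on opposite sides of a rectangle. -/
lemma residue_eq_zero_of_periodic (hx : 0 < x) (hy₁ : y₁ < 0) (hy₂ : 0 < y₂) {F g : ℂ → ℂ}
    {w₀ w₁ : ℂ} (hg : DifferentiableOn ℂ g (Set.Icc (-x) x ×ℂ Set.Icc y₁ y₂))
    (hF : ∀ z ∈ Set.Icc (-x) x ×ℂ Set.Icc y₁ y₂, z ≠ 0 → F z = w₀ * (z ^ 2)⁻¹ + w₁ * z⁻¹ + g z)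
    (hv : ∀ s ∈ Set.Icc y₁ y₂, F (x + s * Complex.I) = F (-x + s * Complex.I))
    (hh : ∀ s ∈ Set.Icc (-x) x, F (y₁ * Complex.I + s) = F (y₂ * Complex.I + s)) : w₁ = 0 := by
  have hy : y₁ < y₂ := hy₁.trans hy₂
  have hxx : -x < x := by linarith
  have nh {c : ℝ} (hc : c ≠ 0) (s : ℝ) : c * Complex.I + s * 1 ≠ 0 := fun h => hc (by
    simpa using congrArg Complex.im h)
  have nv {c : ℝ} (hc : c ≠ 0) (s : ℝ) : (c : ℂ) + s * Complex.I ≠ 0 := fun h => hc (by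
    simpa using congrArg Complex.re h)
  have sh {c : ℝ} (hc : c ∈ Set.Icc y₁ y₂) (s : ℝ) (hs : s ∈ Set.uIcc (-x) x) :
      c * Complex.I + s * 1 ∈ Set.Icc (-x) x ×ℂ Set.Icc y₁ y₂ := by
    rw [Set.uIcc_of_le hxx.le] at hs
    rw [Complex.mem_reProdIm]
    simpa using ⟨hs, hc⟩
  have sv {c : ℝ} (hc : c ∈ Set.Icc (-x) x) (s : ℝ) (hs : s ∈ Set.uIcc y₁ y₂) :
      (c : ℂ) + s * Complex.I ∈ Set.Icc (-x) x ×ℂ Set.Icc y₁ y₂ := by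
    rw [Set.uIcc_of_le hy.le] at hs
    rw [Complex.mem_reProdIm]
    simpa using ⟨hc, hs⟩
  have l1 := integral_laurent hg.continuousOn (nh hy₁.ne) (sh (Set.left_mem_Icc.2 hy.le)) hF
  have l2 := integral_laurent hg.continuousOn (nh hy₂.ne') (sh (Set.right_mem_Icc.2 hy.le)) hF
  have l3 := integral_laurent hg.continuousOn (nv hx.ne') (sv (Set.right_mem_Icc.2 hxx.le)) hF
  have l4 := integral_laurent hg.continuousOn (nv (neg_ne_zero.2 hx.ne'))
    (sv (Set.left_mem_Icc.2 hxx.le)) hF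
  have q1 := mul_integral_inv_sq (a := -x) (b := x) (nh hy₁.ne)
  have q2 := mul_integral_inv_sq (a := -x) (b := x) (nh hy₂.ne')
  have q3 := mul_integral_inv_sq (a := y₁) (b := y₂) (nv hx.ne')
  have q4 := mul_integral_inv_sq (a := y₁) (b := y₂) (nv (neg_ne_zero.2 hx.ne'))
  have i1 := im_mul_integral_pos hxx (f := fun s : ℝ => (y₁ * Complex.I + s * 1)⁻¹)
    (by have := nh hy₁.ne; fun_prop (disch := assumption)) 1 fun s => by
      have := Complex.normSq_pos.2 (nh hy₁.ne s)
      rw [one_mul, Complex.inv_im]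
      refine div_pos ?_ this
      simpa using hy₁
  have i2 := im_mul_integral_pos hxx (f := fun s : ℝ => (y₂ * Complex.I + s * 1)⁻¹)
    (by have := nh hy₂.ne'; fun_prop (disch := assumption)) (-1) fun s => by
      have := Complex.normSq_pos.2 (nh hy₂.ne' s)
      rw [neg_one_mul, Complex.neg_im, Complex.inv_im, neg_div, neg_neg]
      refine div_pos ?_ this
      simpa using hy₂
  have i3 := im_mul_integral_pos hy (f := fun s : ℝ => (x + s * Complex.I)⁻¹)
    (by have := nv hx.ne'; fun_prop (disch := assumption)) Complex.I fun s => by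
      have := Complex.normSq_pos.2 (nv hx.ne' s)
      rw [Complex.I_mul_im, Complex.inv_re]
      refine div_pos ?_ this
      simpa using hx
  have i4 := im_mul_integral_pos hy (f := fun s : ℝ => (((-x : ℝ) : ℂ) + s * Complex.I)⁻¹)
    (by have := nv (neg_ne_zero.2 hx.ne'); fun_prop (disch := assumption)) (-Complex.I) fun s => by
      have := Complex.normSq_pos.2 (nv (neg_ne_zero.2 hx.ne') s)
      rw [neg_mul, Complex.neg_im, Complex.I_mul_im, Complex.inv_re, ← neg_div]
      refine div_pos ?_ this
      simpa using hx
  have hgi : (∫ s in -x..x, g (y₁ * Complex.I + s * 1)) - (∫ s in -x..x, g (y₂ * Complex.I + s * 1))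
      + Complex.I * (∫ s in y₁..y₂, g (x + s * Complex.I))
      - Complex.I * ∫ s in y₁..y₂, g (((-x : ℝ) : ℂ) + s * Complex.I) = 0 := by
    have := Complex.integral_boundary_rect_eq_zero_of_continuousOn_of_differentiableOn g
      (⟨-x, y₁⟩) (⟨x, y₂⟩) (by simpa [Set.uIcc_of_le hy.le, Set.uIcc_of_le hxx.le] using
        hg.continuousOn) (by
          refine hg.mono ?_
          simp only [min_eq_left hy.le, max_eq_right hy.le, min_eq_left hxx.le, max_eq_right hxx.le]
          exact fun z hz => ⟨Set.Ioo_subset_Icc_self hz.1, Set.Ioo_subset_Icc_self hz.2⟩)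
    simpa only [smul_eq_mul, mul_one, add_comm (_ * Complex.I) (_ : ℂ)] using this
  have f1 : ∫ s in -x..x, F (y₁ * Complex.I + s * 1) = ∫ s in -x..x, F (y₂ * Complex.I + s * 1) :=
    intervalIntegral.integral_congr fun s hs => by
      rw [Set.uIcc_of_le hxx.le] at hs
      simpa using hh s hs
  have f2 : ∫ s in y₁..y₂, F (x + s * Complex.I) =
      ∫ s in y₁..y₂, F (((-x : ℝ) : ℂ) + s * Complex.I) :=
    intervalIntegral.integral_congr fun s hs => by
      rw [Set.uIcc_of_le hy.le] at hs
      simpa using hv s hs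
  rw [l1, l2] at f1
  rw [l3, l4] at f2
  have key : w₁ * (1 * (∫ s in -x..x, (y₁ * Complex.I + s * 1)⁻¹) +
      (-1) * (∫ s in -x..x, (y₂ * Complex.I + s * 1)⁻¹) +
      Complex.I * (∫ s in y₁..y₂, (x + s * Complex.I)⁻¹) +
      (-Complex.I) * (∫ s in y₁..y₂, (((-x : ℝ) : ℂ) + s * Complex.I)⁻¹)) = 0 := by
    have e (s : ℝ) : ((x : ℂ) + s * Complex.I)⁻¹ = (s * Complex.I + x * 1)⁻¹ := by ring
    have e' (s : ℝ) : (((-x : ℝ) : ℂ) + s * Complex.I)⁻¹ = (s * Complex.I + (-x : ℝ) * 1)⁻¹ := by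
      ring
    rw [e, e] at q3
    rw [e', e'] at q4
    linear_combination f1 + Complex.I * f2 - hgi - w₀ * (q1 - q2 + q3 - q4)
  refine (mul_eq_zero.1 key).resolve_right fun h0 => ?_
  have := congrArg Complex.im h0
  simp only [Complex.add_im, Complex.zero_im] at this
  linarith

/-- If the quotient `J / u ^ 2`, with `u` odd, takes equal values on opposite sides of a rectangle in
which `u` vanishes only at the origin, then the derivative of `J` vanishes there. -/
theorem deriv_eq_zero_of_periodic (hx : 0 < x) (hy₁ : y₁ < 0) (hy₂ : 0 < y₂) {J u : ℂ → ℂ}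
    (hJ : DifferentiableOn ℂ J (Set.Icc (-x) x ×ℂ Set.Icc y₁ y₂)) (hu : Differentiable ℂ u)
    (hodd : ∀ z, u (-z) = -u z) (hu' : deriv u 0 ≠ 0)
    (hu0 : ∀ z ∈ Set.Icc (-x) x ×ℂ Set.Icc y₁ y₂, u z = 0 → z = 0)
    (hv : ∀ s ∈ Set.Icc y₁ y₂, J (x + s * Complex.I) / u (x + s * Complex.I) ^ 2 =
      J (-x + s * Complex.I) / u (-x + s * Complex.I) ^ 2)
    (hh : ∀ s ∈ Set.Icc (-x) x, J (y₁ * Complex.I + s) / u (y₁ * Complex.I + s) ^ 2 =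
      J (y₂ * Complex.I + s) / u (y₂ * Complex.I + s) ^ 2) : deriv J 0 = 0 := by
  have hmem : Set.Icc (-x) x ×ℂ Set.Icc y₁ y₂ ∈ 𝓝 (0 : ℂ) := by
    refine mem_of_superset ((isOpen_Ioo.reProdIm isOpen_Ioo).mem_nhds
      (show (0 : ℂ) ∈ Set.Ioo (-x) x ×ℂ Set.Ioo y₁ y₂ from ?_)) fun z hz =>
        ⟨Set.Ioo_subset_Icc_self hz.1, Set.Ioo_subset_Icc_self hz.2⟩
    rw [Complex.mem_reProdIm]
    simpa using ⟨hx, hy₁, hy₂⟩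
  have hu00 : u 0 = 0 := by
    have := hodd 0
    rw [neg_zero] at this
    exact self_eq_neg.1 this
  have hk : Differentiable ℂ (dslope u 0) := by
    rw [← differentiableOn_univ] at hu ⊢
    exact (Complex.differentiableOn_dslope univ_mem).2 hu
  have huk (z : ℂ) : u z = z * dslope u 0 z := by
    simpa [hu00] using (sub_smul_dslope u 0 z).symm
  have hk0 : dslope u 0 0 = deriv u 0 := dslope_same _ _
  have hkne (z : ℂ) (hz : z ∈ Set.Icc (-x) x ×ℂ Set.Icc y₁ y₂) : dslope u 0 z ≠ 0 := by
    by_cases h : z = 0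
    · rw [h, hk0]; exact hu'
    · exact fun h' => h (hu0 z hz (by rw [huk, h', mul_zero]))
  have hkeven (z : ℂ) : dslope u 0 (-z) = dslope u 0 z := by
    by_cases h : z = 0
    · rw [h, neg_zero]
    · have := hodd z
      rw [huk, huk z] at this
      exact mul_left_cancel₀ h (by linear_combination -this)
  have hk' : deriv (dslope u 0) 0 = 0 := by
    have h1 := ((hk (-0)).hasDerivAt.scomp 0 (hasDerivAt_neg 0)).deriv
    have h2 : dslope u 0 ∘ Neg.neg = dslope u 0 := funext hkeven
    rw [h2, neg_zero] at h1
    simpa using self_eq_neg.1 (h1.trans (neg_one_smul _ _))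
  have hW : DifferentiableOn ℂ (fun z => J z / dslope u 0 z ^ 2) (Set.Icc (-x) x ×ℂ Set.Icc y₁ y₂) :=
    hJ.div (hk.differentiableOn.pow 2) fun z hz => pow_ne_zero 2 (hkne z hz)
  set W := fun z => J z / dslope u 0 z ^ 2 with hWdef
  have hW1 := (Complex.differentiableOn_dslope hmem).2 hW
  have hg := (Complex.differentiableOn_dslope hmem).2 hW1
  have hres := residue_eq_zero_of_periodic (F := fun z => J z / u z ^ 2) (w₀ := W 0)
    (w₁ := dslope W 0 0) hx hy₁ hy₂ hg (fun z hz h => by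
      have h1 := sub_smul_dslope W 0 z
      have h2 := sub_smul_dslope (dslope W 0) 0 z
      rw [sub_zero, smul_eq_mul] at h1 h2
      have h3 : J z / u z ^ 2 = W z * (z ^ 2)⁻¹ := by
        rw [huk, hWdef, mul_pow]
        field_simp
      rw [h3]
      field_simp
      linear_combination -z * h2 - h1) hv hh
  rw [dslope_same] at hres
  have hJ0 : DifferentiableAt ℂ J 0 := hJ.differentiableAt hmem
  have h0 : deriv u 0 ≠ 0 := hu'
  have hd := (hJ0.hasDerivAt.div ((hk 0).hasDerivAt.pow 2) (pow_ne_zero 2 (hk0 ▸ hu'))).deriv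
  have hd' : deriv W 0 = _ := hd
  rw [hd', hk'] at hres
  simp only [Pi.pow_apply, hk0, mul_zero, sub_zero] at hres
  simpa [hu'] using hres

end Residue

section Solution

variable {η r δ : ℝ} {s : ℂ} {α : ℝ}

/-- The solution of the functional equation for walks, with a particular solution removed. -/
def homSol (η : ℝ) (s z : ℂ) : ℂ :=
  s * cellGen (cellVar η) (wtB s (kerX η z)) - cellGen (cellVar η) (wtA s (kerX η z)) / kerX η (-z)
    - (s * (1 / (kerX η z * kerX η (-z))) + s ^ 2 * (1 / kerX η z) + s ^ 3)
      / (cellVar η * (1 - s ^ 3))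

lemma kerX_ne_zero {z : ℂ} (hu : imTheta (3 * η) z ≠ 0)
    (hv : imTheta (3 * η) (z + Complex.I * η) ≠ 0) (hw : imTheta (3 * η) (z - Complex.I * η) ≠ 0) :
    kerX η z ≠ 0 :=
  neg_ne_zero.2 <| div_ne_zero (mul_ne_zero (mul_ne_zero (mul_ne_zero (Complex.exp_ne_zero _)
    (Complex.exp_ne_zero _)) hu) hw) (pow_ne_zero 2 hv)

lemma kerX_neg_ne_zero {z : ℂ} (hu : imTheta (3 * η) z ≠ 0)
    (hv : imTheta (3 * η) (z + Complex.I * η) ≠ 0) (hw : imTheta (3 * η) (z - Complex.I * η) ≠ 0) :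
    kerX η (-z) ≠ 0 := by
  refine kerX_ne_zero ?_ ?_ ?_
  · rw [imTheta_neg]; exact neg_ne_zero.2 hu
  · rw [imTheta_neg_add]; exact neg_ne_zero.2 hw
  · rw [imTheta_neg_sub]; exact neg_ne_zero.2 hv

lemma kerX_neg_add_I_mul (η : ℝ) (z : ℂ) : kerX η (-(z + Complex.I * η)) =
    imTheta (3 * η) (z + Complex.I * η) * imTheta (3 * η) (z - Complex.I * η) /
      (Complex.exp (η / 3) ^ 2 * imTheta (3 * η) z ^ 2) := by
  have hE : Complex.exp (2 * Complex.I * z) ≠ 0 := Complex.exp_ne_zero _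
  have hp0 : Complex.exp (η / 3) ≠ 0 := Complex.exp_ne_zero _
  rw [kerX_neg]
  simp only [imTheta_add_two_mul, add_sub_cancel_right, Complex.exp_add, exp_neg_two_I_mul,
      exp_two_I_mul_add, exp_eq_exp_third_pow η]
  field_simp

lemma homSol_add_I_mul (hη : 0 < η) (hr : cellVar η = r) (hr0 : 0 < r) (hr1 : r < 1 / 3)
    (hs : ‖s‖ = 1) (hs3 : s ^ 3 ≠ 1) {z : ℂ} (hu : imTheta (3 * η) z ≠ 0)
    (hv : imTheta (3 * η) (z + Complex.I * η) ≠ 0) (hw : imTheta (3 * η) (z - Complex.I * η) ≠ 0)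
    (hX : ‖kerX η z‖ < 1) (hY : ‖kerX η (-z)‖ < 1) :
    homSol η s (z + Complex.I * η) = s * kerX η z * homSol η s z := by
  have ht : cellVar η ≠ 0 := by rw [hr]; exact_mod_cast hr0.ne'
  have ht3 : ‖cellVar η‖ < 1 / 3 := by
    rw [hr, Complex.norm_real, Real.norm_of_nonneg hr0.le]; exact hr1
  have hs0 : s ≠ 0 := norm_ne_zero_iff.1 (by rw [hs]; exact one_ne_zero)
  have hs3' : 1 - s ^ 3 ≠ 0 := sub_ne_zero.2 hs3.symm
  have hx := kerX_ne_zero hu hv hw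
  have hy := kerX_neg_ne_zero hu hv hw
  have hk := cellGen_kernel ht3 hs hX.le hY.le hx hy (kerX_kernel hη ht hu hv hw)
  have h2 : kerX η (-(z + Complex.I * η)) = 1 / (kerX η z * kerX η (-z)) := by
    rw [kerX_mul_kerX_neg, kerX_neg_add_I_mul]
    field_simp
  rw [homSol, homSol, h2, kerX_add_I_mul]
  field_simp at hk ⊢
  linear_combination (s ^ 3 - 1) * hk

/-- The auxiliary elliptic factor. -/
def auxFactor (η α : ℝ) (z : ℂ) : ℂ :=
  Complex.exp (-2 * Complex.I * z) * imTheta η (z + (α / 2 - 2 * (Complex.I * η) / 3)) /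
    (imTheta (3 * η) (z + Complex.I * η) ^ 2 * imTheta (3 * η) (z - Complex.I * η))

lemma auxFactor_add_I_mul (hsα : s = Complex.exp (Complex.I * α)) {z : ℂ}
    (hu : imTheta (3 * η) z ≠ 0)
    (hv : imTheta (3 * η) (z + Complex.I * η) ≠ 0) (hw : imTheta (3 * η) (z - Complex.I * η) ≠ 0) :
    auxFactor η α z = s * kerX η z * auxFactor η α (z + Complex.I * η) := by
  have hE : Complex.exp (2 * Complex.I * z) ≠ 0 := Complex.exp_ne_zero _
  have hp0 : Complex.exp (η / 3) ≠ 0 := Complex.exp_ne_zero _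
  have hs0 : s ≠ 0 := hsα ▸ Complex.exp_ne_zero _
  have he : Complex.exp (-2 * Complex.I * (z + (α / 2 - 2 * (Complex.I * η) / 3)) + η) =
      (s * Complex.exp (η / 3) * Complex.exp (2 * Complex.I * z))⁻¹ := by
    rw [hsα, ← Complex.exp_add, ← Complex.exp_add, ← Complex.exp_neg]
    congr 1
    linear_combination 4 / 3 * η * Complex.I_sq
  rw [auxFactor, auxFactor, kerX, add_right_comm z (Complex.I * (η : ℂ)), imTheta_add_I_mul, he]
  simp only [imTheta_add_two_mul, add_sub_cancel_right, Complex.exp_add, exp_neg_two_I_mul,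
      exp_two_I_mul_add, exp_eq_exp_third_pow η]
  generalize imTheta (3 * η) (z + Complex.I * η) = v at *
  generalize imTheta (3 * η) (z - Complex.I * η) = w at *
  field_simp

/-- The part of the numerator carrying a zero at the origin. -/
def numPart (η : ℝ) (s z : ℂ) : ℂ :=
  imTheta (3 * η) z * (s * cellGen (cellVar η) (wtB s (kerX η z))) +
    cellGen (cellVar η) (wtA s (kerX η z)) * ((Complex.exp (η / 3))⁻¹ *
      Complex.exp (-2 * Complex.I * z) * imTheta (3 * η) (z - Complex.I * η) ^ 2 /
        imTheta (3 * η) (z + Complex.I * η)) +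
    s ^ 2 / (cellVar η * (1 - s ^ 3)) * ((Complex.exp (η / 3))⁻¹ *
      Complex.exp (2 * Complex.I * z) * imTheta (3 * η) (z + Complex.I * η) ^ 2 /
        imTheta (3 * η) (z - Complex.I * η)) -
    s ^ 3 / (cellVar η * (1 - s ^ 3)) * imTheta (3 * η) z

/-- The numerator of the elliptic function `auxFactor * homSol`. -/
def ellNum (η α : ℝ) (s z : ℂ) : ℂ :=
  auxFactor η α z * (imTheta (3 * η) z * numPart η s z -
    s / (cellVar η * (1 - s ^ 3)) / Complex.exp (η / 3) ^ 2 *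
      (imTheta (3 * η) (z + Complex.I * η) * imTheta (3 * η) (z - Complex.I * η)))

lemma ellNum_div {z : ℂ} (hu : imTheta (3 * η) z ≠ 0)
    (hv : imTheta (3 * η) (z + Complex.I * η) ≠ 0) (hw : imTheta (3 * η) (z - Complex.I * η) ≠ 0) :
    ellNum η α s z / imTheta (3 * η) z ^ 2 = auxFactor η α z * homSol η s z := by
  have hE : Complex.exp (2 * Complex.I * z) ≠ 0 := Complex.exp_ne_zero _
  have hp0 : Complex.exp (η / 3) ≠ 0 := Complex.exp_ne_zero _
  rw [ellNum, mul_div_assoc]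
  congr 1
  rw [homSol, numPart, kerX_mul_kerX_neg]
  generalize cellGen (cellVar η) (wtA s (kerX η z)) = a
  generalize cellGen (cellVar η) (wtB s (kerX η z)) = b
  rw [kerX_neg, kerX, exp_neg_two_I_mul, div_eq_mul_inv _ (cellVar η * (1 - s ^ 3)),
    div_eq_mul_inv _ (cellVar η * (1 - s ^ 3)), div_eq_mul_inv _ (cellVar η * (1 - s ^ 3)),
    div_eq_mul_inv _ (cellVar η * (1 - s ^ 3))]
  generalize (cellVar η * (1 - s ^ 3))⁻¹ = c
  generalize imTheta (3 * η) (z + Complex.I * η) = v at *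
  generalize imTheta (3 * η) (z - Complex.I * η) = w at *
  field_simp
  ring

lemma ellNum_div_add_I_mul (hη : 0 < η) (hr : cellVar η = r) (hr0 : 0 < r) (hr1 : r < 1 / 3)
    (hs : ‖s‖ = 1) (hs3 : s ^ 3 ≠ 1) (hsα : s = Complex.exp (Complex.I * α))
    {z : ℂ} (hu : imTheta (3 * η) z ≠ 0)
    (hv : imTheta (3 * η) (z + Complex.I * η) ≠ 0) (hw : imTheta (3 * η) (z - Complex.I * η) ≠ 0)
    (hX : ‖kerX η z‖ < 1) (hY : ‖kerX η (-z)‖ < 1) :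
    ellNum η α s (z + Complex.I * η) / imTheta (3 * η) (z + Complex.I * η) ^ 2 =
      ellNum η α s z / imTheta (3 * η) z ^ 2 := by
  rw [ellNum_div hu hv hw, ellNum_div hv _ (by rwa [add_sub_cancel_right]),
    homSol_add_I_mul hη hr hr0 hr1 hs hs3 hu hv hw hX hY, auxFactor_add_I_mul hsα hu hv hw]
  · ring
  · rw [imTheta_add_two_mul]
    exact mul_ne_zero (neg_ne_zero.2 (Complex.exp_ne_zero _)) hw

lemma ellNum_add_pi (η α : ℝ) (s z : ℂ) : ellNum η α s (z + Real.pi) = ellNum η α s z := by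
  simp only [ellNum, numPart, auxFactor, kerX_add_pi, exp_neg_two_I_mul, exp_two_I_mul_add_pi,
    add_right_comm z _ (Complex.I * (η : ℂ)), add_right_comm z _ ((α : ℂ) / 2 - _),
    add_sub_right_comm, imTheta_add_pi]
  ring

lemma differentiableAt_cellGen_kerX (hη : 0 < η) (hr : cellVar η = r) (hr0 : 0 < r)
    (hr1 : r < 1 / 3) (hs : ‖s‖ = 1) {z : ℂ} (h0 : -η < z.im) (h1 : z.im < η)
    (hX : ‖kerX η z‖ < 1) :
    DifferentiableAt ℂ (fun z => cellGen (cellVar η) (wtA s (kerX η z))) z ∧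
    DifferentiableAt ℂ (fun z => cellGen (cellVar η) (wtB s (kerX η z))) z := by
  have ht3 : ‖cellVar η‖ < 1 / 3 := by
    rw [hr, Complex.norm_real, Real.norm_of_nonneg hr0.le]; exact hr1
  have hmem : Metric.ball (0 : ℂ) 1 ∈ 𝓝 (kerX η z) := Metric.isOpen_ball.mem_nhds (by simpa using hX)
  have hd := differentiableAt_kerX hη h0 (h1.trans (by linarith))
  exact ⟨((differentiableOn_cellGen_wtA ht3 hs).differentiableAt hmem).fun_comp' z hd,
    ((differentiableOn_cellGen_wtB ht3 hs).differentiableAt hmem).fun_comp' z hd⟩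

lemma differentiableAt_numPart (hη : 0 < η) (hr : cellVar η = r) (hr0 : 0 < r)
    (hr1 : r < 1 / 3) (hs : ‖s‖ = 1) {z : ℂ} (h0 : -η < z.im) (h1 : z.im < η)
    (hX : ‖kerX η z‖ < 1) : DifferentiableAt ℂ (numPart η s) z := by
  have hd := differentiable_imTheta (three_mul_pos_of_pos hη)
  have hv := imTheta_add_ne_zero hη h0 (by linarith)
  have hw := imTheta_sub_ne_zero hη (by linarith) h1
  obtain ⟨hA, hB⟩ := differentiableAt_cellGen_kerX hη hr hr0 hr1 hs h0 h1 hX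
  unfold numPart
  fun_prop (disch := assumption)

lemma differentiableAt_auxFactor (hη : 0 < η) {z : ℂ} (h0 : -η < z.im) (h1 : z.im < η) :
    DifferentiableAt ℂ (auxFactor η α) z := by
  have hd := differentiable_imTheta (three_mul_pos_of_pos hη)
  have hd' := differentiable_imTheta hη
  have hv := mul_ne_zero (pow_ne_zero 2 (imTheta_add_ne_zero hη h0 (by linarith)))
    (imTheta_sub_ne_zero hη (by linarith) h1)
  unfold auxFactor
  fun_prop (disch := assumption)

lemma differentiableAt_ellNum (hη : 0 < η) (hr : cellVar η = r) (hr0 : 0 < r)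
    (hr1 : r < 1 / 3) (hs : ‖s‖ = 1) {z : ℂ} (h0 : -η < z.im) (h1 : z.im < η)
    (hX : ‖kerX η z‖ < 1) : DifferentiableAt ℂ (ellNum η α s) z := by
  have hd := differentiable_imTheta (three_mul_pos_of_pos hη)
  have h2 := differentiableAt_numPart hη hr hr0 hr1 hs h0 h1 hX
  have h3 := differentiableAt_auxFactor (α := α) hη h0 h1
  unfold ellNum
  fun_prop

theorem deriv_ellNum_zero (hη : 0 < η) (hr : cellVar η = r) (hr0 : 0 < r) (hr1 : r < 1 / 3)
    (hs3 : s ^ 3 ≠ 1) (hsα : s = Complex.exp (Complex.I * α)) :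
    deriv (ellNum η α s) 0 = 0 := by
  obtain ⟨δ, hδ, hδη, hX⟩ := exists_norm_kerX_lt_one hη hr hr0 hr1
  have ht : cellVar η ≠ 0 := by rw [hr]; exact_mod_cast hr0.ne'
  have hs : ‖s‖ = 1 := by rw [hsα, mul_comm, Complex.norm_exp_ofReal_mul_I]
  refine deriv_eq_zero_of_periodic (x := Real.pi / 2) (y₁ := -δ) (y₂ := η - δ)
    (u := imTheta (3 * η)) (by positivity) (by linarith) (by linarith) ?_
    (differentiable_imTheta (three_mul_pos_of_pos hη)) (imTheta_neg _) (deriv_imTheta_ne_zero ht)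
    ?_ ?_ ?_
  · intro z hz
    obtain ⟨-, h1, h2⟩ := hz
    exact (differentiableAt_ellNum hη hr hr0 hr1 hs (by linarith) (by linarith)
      (hX z h1 (by linarith))).differentiableWithinAt
  · intro z hz h
    obtain ⟨h0, h1⟩ := hz
    obtain ⟨m, n, rfl⟩ := exists_of_imTheta_eq_zero (three_mul_pos_of_pos hη) h
    have him : ((m : ℂ) * Real.pi + n * (Complex.I * (3 * η : ℝ))).im = n * (3 * η) := by simp
    have hre : ((m : ℂ) * Real.pi + n * (Complex.I * (3 * η : ℝ))).re = m * Real.pi := by simp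
    rw [Set.mem_preimage, hre] at h0
    rw [Set.mem_preimage, him] at h1
    have hn : n = 0 := by
      have h2 : (n : ℝ) < 1 := by nlinarith [h1.1, h1.2]
      have h3 : (-1 : ℝ) < n := by nlinarith [h1.1, h1.2]
      have h2' : n < 1 := by exact_mod_cast h2
      have h3' : -1 < n := by exact_mod_cast h3
      omega
    have hm : m = 0 := by
      have h2 : (m : ℝ) < 1 := by nlinarith [h0.1, h0.2, Real.pi_pos]
      have h3 : (-1 : ℝ) < m := by nlinarith [h0.1, h0.2, Real.pi_pos]
      have h2' : m < 1 := by exact_mod_cast h2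
      have h3' : -1 < m := by exact_mod_cast h3
      omega
    simp [hn, hm]
  · intro y hy
    have : ((Real.pi / 2 : ℝ) : ℂ) + y * Complex.I
        = -((Real.pi / 2 : ℝ) : ℂ) + y * Complex.I + Real.pi := by push_cast; ring
    rw [this, ellNum_add_pi, imTheta_add_pi, neg_sq]
  · intro x hx
    have e : ((η - δ : ℝ) : ℂ) * Complex.I + x = ((-δ : ℝ) : ℂ) * Complex.I + x + Complex.I * η := by
      push_cast; ring
    have him : (((-δ : ℝ) : ℂ) * Complex.I + x).im = -δ := by simp
    rw [e]
    refine (ellNum_div_add_I_mul hη hr hr0 hr1 hs hs3 hsα ?_ ?_ ?_ ?_ ?_).symm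
    · apply imTheta_ne_zero_of_im (three_mul_pos_of_pos hη) <;>
        rw [him, abs_neg, abs_of_pos hδ] <;> linarith
    · apply imTheta_add_ne_zero hη <;> rw [him] <;> linarith
    · apply imTheta_sub_ne_zero hη <;> rw [him] <;> linarith
    · apply hX <;> rw [him]; linarith
    · apply hX <;> rw [Complex.neg_im, him] <;> linarith

lemma hasDerivAt_exp_mul_zero (c : ℂ) : HasDerivAt (fun z => Complex.exp (c * z)) c 0 := by
  simpa using ((hasDerivAt_id (0 : ℂ)).const_mul c).cexp

lemma hasDerivAt_imTheta_add_zero (hη : 0 < η) (c : ℂ) :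
    HasDerivAt (fun z => imTheta η (z + c)) (deriv (imTheta η) c) 0 := by
  have := ((differentiable_imTheta hη (0 + c)).hasDerivAt.comp_add_const 0 c)
  rwa [zero_add] at this

lemma hasDerivAt_imTheta_sub_zero (hη : 0 < η) (c : ℂ) :
    HasDerivAt (fun z => imTheta η (z - c)) (deriv (imTheta η) c) 0 := by
  have := hasDerivAt_imTheta_add_zero hη (-c)
  rwa [deriv_imTheta_neg hη] at this

lemma deriv_imTheta_two_mul (hη : 0 < η) :
    deriv (imTheta (3 * η)) (Complex.I * η + Complex.I * η) = -Complex.exp η *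
      (2 * Complex.I * imTheta (3 * η) (Complex.I * η)
        + deriv (imTheta (3 * η)) (Complex.I * η)) := by
  have h3 := three_mul_pos_of_pos hη
  have h1 := hasDerivAt_imTheta_add_zero h3 (Complex.I * η + Complex.I * η)
  have h2 := ((hasDerivAt_exp_mul_zero (-2 * Complex.I)).mul
    (hasDerivAt_imTheta_sub_zero h3 (Complex.I * η))).const_mul (-Complex.exp η)
  have he : (fun z => imTheta (3 * η) (z + (Complex.I * η + Complex.I * η))) = fun z =>
      -Complex.exp η * (Complex.exp (-2 * Complex.I * z) * imTheta (3 * η) (z - Complex.I * η)) := by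
    funext z
    rw [← add_assoc, imTheta_add_two_mul, Complex.exp_add]
    ring
  rw [he] at h1
  rw [h1.unique h2, zero_sub, imTheta_neg, mul_zero, Complex.exp_zero]
  ring

lemma imTheta_shift_ne_zero (hη : 0 < η) (α : ℝ) :
    imTheta η (α / 2 - 2 * (Complex.I * η) / 3) ≠ 0 := by
  have him : ((α : ℂ) / 2 - 2 * (Complex.I * η) / 3).im = -(2 / 3 * η) := by
    have : (α : ℂ) / 2 - 2 * (Complex.I * η) / 3 =
      ((α / 2 : ℝ) : ℂ) - ((2 / 3 * η : ℝ) : ℂ) * Complex.I := by push_cast; ring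
    rw [this]; simp
  apply imTheta_ne_zero_of_im hη <;> rw [him, abs_neg, abs_of_pos (by positivity)] <;> linarith

theorem cellGen_zero (hη : 0 < η) (hr : cellVar η = r) (hr0 : 0 < r) (hr1 : r < 1 / 3)
    (hs3 : s ^ 3 ≠ 1) (hsα : s = Complex.exp (Complex.I * α)) :
    cellGen (cellVar η) (wtA s 0) = s / (cellVar η * (1 - s ^ 3)) *
      (s + (Complex.exp (η / 3))⁻¹ * (2 * Complex.I * imTheta (3 * η) (Complex.I * η)
        + deriv (imTheta (3 * η)) (Complex.I * η)) / deriv (imTheta (3 * η)) 0 -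
        (Complex.exp (η / 3))⁻¹ * imTheta (3 * η) (Complex.I * η) *
          deriv (imTheta η) (α / 2 - 2 * (Complex.I * η) / 3) /
          (deriv (imTheta (3 * η)) 0 * imTheta η (α / 2 - 2 * (Complex.I * η) / 3))) := by
  have h3 := three_mul_pos_of_pos hη
  have ht : cellVar η ≠ 0 := by rw [hr]; exact_mod_cast hr0.ne'
  have hs : ‖s‖ = 1 := by rw [hsα, mul_comm, Complex.norm_exp_ofReal_mul_I]
  have hs3' : 1 - s ^ 3 ≠ 0 := sub_ne_zero.2 hs3.symm
  have hp0 : Complex.exp (η / 3) ≠ 0 := Complex.exp_ne_zero _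
  have hV := imTheta_three_ne_zero hη
  have hT := imTheta_shift_ne_zero hη α
  have hΘ := deriv_imTheta_ne_zero ht
  have hu := (differentiable_imTheta h3 0).hasDerivAt
  have hv := hasDerivAt_imTheta_add_zero h3 (Complex.I * η)
  have hw := hasDerivAt_imTheta_sub_zero h3 (Complex.I * η)
  have hϑ := hasDerivAt_imTheta_add_zero hη (α / 2 - 2 * (Complex.I * η) / 3)
  have hw0 : imTheta (3 * η) (0 - Complex.I * η) = -imTheta (3 * η) (Complex.I * η) := by
    rw [zero_sub, imTheta_neg]
  have hn := (differentiableAt_numPart (s := s) hη hr hr0 hr1 hs (z := 0) (by simpa using hη)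
    (by simpa using hη) (by simp [kerX_zero])).hasDerivAt
  have hn0 : numPart η s 0 = (cellGen (cellVar η) (wtA s 0) - s ^ 2 / (cellVar η * (1 - s ^ 3))) *
      ((Complex.exp (η / 3))⁻¹ * imTheta (3 * η) (Complex.I * η)) := by
    rw [numPart, kerX_zero, hw0, imTheta_zero, zero_add, mul_zero, mul_zero, Complex.exp_zero]
    field_simp
    ring
  have haux := ((hasDerivAt_exp_mul_zero (-2 * Complex.I)).mul hϑ).div ((hv.pow 2).mul hw)
    (by simpa [hw0, imTheta_neg] using hV)
  have hJ := haux.mul ((hu.mul hn).sub ((hv.mul hw).const_mul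
    (s / (cellVar η * (1 - s ^ 3)) / Complex.exp (η / 3) ^ 2)))
  have h0 := hJ.deriv.symm.trans (deriv_ellNum_zero hη hr hr0 hr1 hs3 hsα)
  simp only [Pi.mul_apply, Pi.div_apply, Pi.sub_apply, Pi.pow_apply, hn0, hw0, imTheta_zero,
    zero_add, mul_zero, zero_mul, Complex.exp_zero, one_mul] at h0
  clear hJ haux hn hn0 hϑ hu hv hw hw0
  generalize cellGen (cellVar η) (wtA s 0) = E at *
  obtain ⟨c, hc⟩ : ∃ c, c = cellVar η * (1 - s ^ 3) := ⟨_, rfl⟩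
  rw [← hc] at h0 ⊢
  replace hc : c ≠ 0 := hc ▸ mul_ne_zero ht hs3'
  generalize deriv (imTheta (3 * η)) (Complex.I * η) = V' at *
  generalize imTheta (3 * η) (Complex.I * η) = V at *
  generalize deriv (imTheta (3 * η)) 0 = Θ' at *
  generalize deriv (imTheta η) (α / 2 - 2 * (Complex.I * η) / 3) = L at *
  generalize imTheta η (α / 2 - 2 * (Complex.I * η) / 3) = T at *
  generalize Complex.exp (η / 3) = p at *
  field_simp at h0 ⊢
  refine mul_left_cancel₀ (pow_ne_zero 3 hV) ?_
  push_cast at h0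
  linear_combination -h0

end Solution

/-- the theta-function form of `E(t, e^{iα})`. -/
theorem cell_excursions_theta_form
    (y : ℝ) (hy : 0 < y) (τ : ℂ) (hτ : τ = Complex.I * y)
    (t : ℂ)
    (ht : t = Complex.exp (-(Real.pi : ℂ) * τ * Complex.I / 3) * jTheta' 0 (3 * τ) /
        (4 * Complex.I * jTheta (Real.pi * τ) (3 * τ) + 6 * jTheta' (Real.pi * τ) (3 * τ)))
    (htIm : t.im = 0) (ht0 : 0 < t.re) (ht1 : t.re < 1 / 3)
    (α : ℝ) (hα : Complex.exp (3 * Complex.I * α) ≠ 1) :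
    ∑' n : ℕ, t ^ n * ∑' k : ℤ, (eCell n k : ℂ) * Complex.exp (Complex.I * k * α) =
      Complex.exp (Complex.I * α) / (t * (1 - Complex.exp (3 * Complex.I * α))) *
        (Complex.exp (Complex.I * α) -
          Complex.exp (4 * Real.pi * τ * Complex.I / 3) *
            jTheta' (2 * Real.pi * τ) (3 * τ) / jTheta' 0 (3 * τ) -
          Complex.exp (Real.pi * τ * Complex.I / 3) * jTheta (Real.pi * τ) (3 * τ) *
            jTheta' ((α : ℂ) / 2 - 2 * Real.pi * τ / 3) τ /
            (jTheta' 0 (3 * τ) * jTheta ((α : ℂ) / 2 - 2 * Real.pi * τ / 3) τ)) := by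
  obtain ⟨η, hη⟩ : ∃ η : ℝ, η = Real.pi * y := ⟨_, rfl⟩
  have hη0 : 0 < η := hη ▸ mul_pos Real.pi_pos hy
  have hπτ : (Real.pi : ℂ) * τ = Complex.I * η := by rw [hτ, hη]; push_cast; ring
  have hΘ : ∀ z, jTheta z τ = imTheta η z := fun z => by
    rw [imTheta, hτ, hη, mul_div_cancel_left₀ _ Real.pi_ne_zero]
  have hΘ3 : ∀ z, jTheta z (3 * τ) = imTheta (3 * η) z := fun z => by
    rw [imTheta, hτ, hη, mul_left_comm 3 Real.pi, mul_div_cancel_left₀ _ Real.pi_ne_zero,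
      mul_left_comm, Complex.ofReal_mul, Complex.ofReal_ofNat]
  have hD : ∀ z, jTheta' z τ = deriv (imTheta η) z := fun z => by
    rw [jTheta', funext hΘ]
  have hD3 : ∀ z, jTheta' z (3 * τ) = deriv (imTheta (3 * η)) z := fun z => by
    rw [jTheta', funext hΘ3]
  have h2 : 2 * (Real.pi : ℂ) * τ = Complex.I * η + Complex.I * η := by
    rw [mul_assoc, hπτ]; ring
  have h2' : 2 * (Real.pi : ℂ) * τ / 3 = 2 * (Complex.I * η) / 3 := by rw [mul_assoc, hπτ]
  have he1 : Complex.exp (-(Real.pi : ℂ) * τ * Complex.I / 3) = Complex.exp (η / 3) := by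
    congr 1
    linear_combination -Complex.I / 3 * hπτ - η / 3 * Complex.I_sq
  have he2 : Complex.exp (Real.pi * τ * Complex.I / 3) = (Complex.exp (η / 3))⁻¹ := by
    rw [← Complex.exp_neg]
    congr 1
    linear_combination Complex.I / 3 * hπτ + η / 3 * Complex.I_sq
  have he4 : Complex.exp (4 * Real.pi * τ * Complex.I / 3) =
      (Complex.exp (η / 3))⁻¹ * (Complex.exp η)⁻¹ := by
    rw [← Complex.exp_neg, ← Complex.exp_neg, ← Complex.exp_add]
    congr 1
    linear_combination 4 * Complex.I / 3 * hπτ + 4 * η / 3 * Complex.I_sq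
  have hs3 : Complex.exp (Complex.I * α) ^ 3 = Complex.exp (3 * Complex.I * α) := by
    rw [← Complex.exp_nat_mul]
    congr 1
    push_cast
    ring
  have htη : cellVar η = t := by
    rw [ht, he1, hπτ, hΘ3, hD3, hD3, cellVar]
  have htr : cellVar η = (t.re : ℂ) :=
    htη.trans (Complex.ext rfl (by simpa using htIm))
  have hk : ∀ k : ℤ, Complex.exp (Complex.I * k * α) = Complex.exp (Complex.I * α) ^ k :=
    fun k => by
      rw [← Complex.exp_int_mul]
      congr 1
      ring
  have hE := Complex.exp_ne_zero (η : ℂ)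
  simp_rw [hk]
  rw [tsum_tsum_eCell, ← htη, cellGen_zero hη0 htr ht0 ht1 (hs3 ▸ hα) rfl, hs3,
    he2, he4, h2', h2, hπτ]
  simp only [hΘ, hΘ3, hD, hD3]
  rw [deriv_imTheta_two_mul hη0]
  congr 2
  field_simp
  ring
end
end
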